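/- arXiv:1011.0054 — 12 statements merged into one kernel-verified Lean document; each statement's English description precedes it below -/
import Mathlib

section
/- Let 𝕜 be ℝ or ℂ, H a Hilbert space over 𝕜, and V a closed subspace of H with orthogonal projection P_V. Let H^∞ = ℓ²(ℕ, H) and define Shift(V) : H^∞ → H^∞ by (Shift(V)x)_i = P_V(x_{i+1}) + (x_i − P_V(x_i)). Then Shift(V) is a well-defined bounded linear operator with ‖Shift(V)‖ ≤ 1 (and ‖Shift(V)‖ = 1 whenever H ≠ {0}); Shift(V) is surjective; and its kernel is exactly { x ∈ H^∞ : x₀ ∈ V and x_i = 0 for all i ≥ 1 }. -/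
/-- `P` is the orthogonal projection of `H` onto the subspace `W`. -/
def IsOrthProj (𝕜 : Type*) [RCLike 𝕜] {H : Type*} [NormedAddCommGroup H]
    [InnerProductSpace 𝕜 H] (W : Submodule 𝕜 H) (P : H →L[𝕜] H) : Prop :=
  (∀ v : H, P v ∈ W) ∧ (∀ v ∈ W, P v = v) ∧ ∀ v : H, v - P v ∈ Wᗮ

/-- `T` is the operator `Shift(W)` on `H^∞ = ℓ²(ℕ, H)`, defined through the
orthogonal projection `P` of `H` onto `W` by
`(T x) i = P (x (i+1)) + (x i - P (x i))`. -/
def ShiftRep (𝕜 : Type*) [RCLike 𝕜] {H : Type*} [NormedAddCommGroup H]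
    [InnerProductSpace 𝕜 H] (W : Submodule 𝕜 H) (P : H →L[𝕜] H)
    (T : lp (fun _ : ℕ => H) 2 →L[𝕜] lp (fun _ : ℕ => H) 2) : Prop :=
  IsOrthProj 𝕜 W P ∧
    ∀ (x : lp (fun _ : ℕ => H) 2) (i : ℕ),
      (T x) i = P (x (i + 1)) + (x i - P (x i))

/-- A sequence in `H` lies in `ℓ²` iff the squares of its norms are summable. -/
theorem memℓp_two_iff_summable_sq {H : Type*} [NormedAddCommGroup H] {f : ℕ → H} :
    Memℓp f 2 ↔ Summable fun i => ‖f i‖ ^ 2 := by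
  rw [memℓp_gen_iff (by norm_num)]
  simp

theorem lp_two_summable_sq {H : Type*} [NormedAddCommGroup H] (x : lp (fun _ : ℕ => H) 2) :
    Summable fun i => ‖x i‖ ^ 2 :=
  memℓp_two_iff_summable_sq.1 (lp.memℓp x)

theorem lp_two_norm_sq {H : Type*} [NormedAddCommGroup H] (x : lp (fun _ : ℕ => H) 2) :
    ‖x‖ ^ 2 = ∑' i, ‖x i‖ ^ 2 := by
  have h := lp.norm_rpow_eq_tsum (p := 2) (by norm_num) x
  simpa using h

namespace Submodule

variable {𝕜 H : Type*} [RCLike 𝕜] [NormedAddCommGroup H] [InnerProductSpace 𝕜 H]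
  (V : Submodule 𝕜 H) [V.HasOrthogonalProjection]

theorem isOrthProj_starProjection : IsOrthProj 𝕜 V V.starProjection :=
  ⟨fun v => V.starProjection_apply_mem v, fun _ hv => starProjection_eq_self_iff.2 hv,
    fun v => V.sub_starProjection_mem_orthogonal v⟩

theorem norm_starProjection_add_sub_sq (u v : H) :
    ‖V.starProjection u + (v - V.starProjection v)‖ ^ 2 =
      ‖V.starProjection u‖ ^ 2 + ‖v - V.starProjection v‖ ^ 2 := by
  have h := norm_add_sq_eq_norm_sq_add_norm_sq_of_inner_eq_zero (𝕜 := 𝕜)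
    (V.starProjection u) (v - V.starProjection v)
    (V.sub_starProjection_mem_orthogonal v _ (V.starProjection_apply_mem u))
  simpa only [sq] using h

theorem norm_sq_eq_starProjection (v : H) :
    ‖v‖ ^ 2 = ‖V.starProjection v‖ ^ 2 + ‖v - V.starProjection v‖ ^ 2 := by
  rw [← norm_starProjection_add_sub_sq, add_sub_cancel]

theorem summable_starProjection_sq (x : lp (fun _ : ℕ => H) 2) :
    Summable fun i => ‖V.starProjection (x i)‖ ^ 2 :=
  (lp_two_summable_sq x).of_nonneg_of_le (fun _ => sq_nonneg _) fun i => by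
    rw [V.norm_sq_eq_starProjection (x i)]
    exact le_add_of_nonneg_right (sq_nonneg _)

theorem summable_sub_starProjection_sq (x : lp (fun _ : ℕ => H) 2) :
    Summable fun i => ‖x i - V.starProjection (x i)‖ ^ 2 :=
  (lp_two_summable_sq x).of_nonneg_of_le (fun _ => sq_nonneg _) fun i => by
    rw [V.norm_sq_eq_starProjection (x i)]
    exact le_add_of_nonneg_left (sq_nonneg _)

theorem memℓp_shift (x : lp (fun _ : ℕ => H) 2) :
    Memℓp (fun i => V.starProjection (x (i + 1)) + (x i - V.starProjection (x i))) 2 := by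
  rw [memℓp_two_iff_summable_sq]
  simp only [norm_starProjection_add_sub_sq]
  exact ((summable_nat_add_iff 1).2 (V.summable_starProjection_sq x)).add
    (V.summable_sub_starProjection_sq x)

/-- The shift along `V` as a linear map on `ℓ²(ℕ, H)`. -/
noncomputable def shiftLinear : lp (fun _ : ℕ => H) 2 →ₗ[𝕜] lp (fun _ : ℕ => H) 2 where
  toFun x := ⟨fun i => V.starProjection (x (i + 1)) + (x i - V.starProjection (x i)),
    V.memℓp_shift x⟩
  map_add' x y := by
    ext i
    simp only [lp.coeFn_add, Pi.add_apply, map_add]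
    abel
  map_smul' c x := by
    ext i
    simp only [lp.coeFn_smul, Pi.smul_apply, map_smul, RingHom.id_apply, smul_add, smul_sub]

theorem shiftLinear_apply (x : lp (fun _ : ℕ => H) 2) (i : ℕ) :
    V.shiftLinear x i = V.starProjection (x (i + 1)) + (x i - V.starProjection (x i)) :=
  rfl

theorem norm_shiftLinear_le (x : lp (fun _ : ℕ => H) 2) : ‖V.shiftLinear x‖ ≤ ‖x‖ := by
  refine le_of_sq_le_sq ?_ (norm_nonneg x)
  have hP := V.summable_starProjection_sq x
  have hQ := V.summable_sub_starProjection_sq x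
  simp only [lp_two_norm_sq, shiftLinear_apply, norm_starProjection_add_sub_sq,
    V.norm_sq_eq_starProjection (x _)]
  rw [((summable_nat_add_iff 1).2 hP).tsum_add hQ, hP.tsum_add hQ, hP.tsum_eq_zero_add]
  gcongr
  exact le_add_of_nonneg_left (sq_nonneg _)

/-- The shift along `V` as a bounded operator on `ℓ²(ℕ, H)`. -/
noncomputable def shift : lp (fun _ : ℕ => H) 2 →L[𝕜] lp (fun _ : ℕ => H) 2 :=
  V.shiftLinear.mkContinuous 1 fun x => by simpa using V.norm_shiftLinear_le x

theorem shift_apply (x : lp (fun _ : ℕ => H) 2) (i : ℕ) :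
    V.shift x i = V.starProjection (x (i + 1)) + (x i - V.starProjection (x i)) :=
  rfl

theorem norm_shift_le : ‖V.shift‖ ≤ 1 :=
  LinearMap.mkContinuous_norm_le _ zero_le_one _

theorem starProjection_starProjection (v : H) :
    V.starProjection (V.starProjection v) = V.starProjection v :=
  starProjection_eq_self_iff.2 (V.starProjection_apply_mem v)

theorem shift_surjective : Function.Surjective V.shift := by
  intro y
  let f : ℕ → H := fun i =>
    (if i = 0 then 0 else V.starProjection (y (i - 1))) + (y i - V.starProjection (y i))
  have hf : Memℓp f 2 := by
    rw [memℓp_two_iff_summable_sq, ← summable_nat_add_iff 1]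
    simp only [f, Nat.add_eq_zero_iff, one_ne_zero, and_false, if_false, Nat.add_sub_cancel,
      norm_starProjection_add_sub_sq]
    exact (V.summable_starProjection_sq y).add
      ((summable_nat_add_iff 1).2 (V.summable_sub_starProjection_sq y))
  refine ⟨⟨f, hf⟩, ?_⟩
  ext i
  rw [shift_apply]
  change V.starProjection (f (i + 1)) + (f i - V.starProjection (f i)) = y i
  rcases i with _ | i <;> simp [f, starProjection_starProjection]

theorem shift_eq_zero_iff (x : lp (fun _ : ℕ => H) 2) :
    V.shift x = 0 ↔ x 0 ∈ V ∧ ∀ i : ℕ, 1 ≤ i → x i = 0 := by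
  constructor
  · intro h
    have key (i : ℕ) : V.starProjection (x (i + 1)) = 0 ∧ x i - V.starProjection (x i) = 0 := by
      have hi : V.starProjection (x (i + 1)) + (x i - V.starProjection (x i)) = 0 := by
        rw [← shift_apply, h]
        rfl
      have hn := V.norm_starProjection_add_sub_sq (x (i + 1)) (x i)
      rw [hi, norm_zero, zero_pow two_ne_zero, eq_comm,
        add_eq_zero_iff_of_nonneg (sq_nonneg _) (sq_nonneg _)] at hn
      simpa using hn
    refine ⟨starProjection_eq_self_iff.1 (sub_eq_zero.1 (key 0).2).symm, fun i hi => ?_⟩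
    obtain ⟨j, rfl⟩ := Nat.exists_eq_add_of_le' hi
    rw [sub_eq_zero.1 (key (j + 1)).2, (key j).1]
  · rintro ⟨h0, h⟩
    ext i
    rw [shift_apply, h (i + 1) (by lia)]
    rcases i with _ | i
    · simp [starProjection_eq_self_iff.2 h0]
    · simp [h (i + 1) (by lia)]

theorem shift_single_zero {v : H} (hv : V.starProjection v = 0) :
    V.shift (lp.single 2 0 v) = lp.single 2 0 v := by
  ext i
  rw [shift_apply]
  rcases i with _ | i <;> simp [lp.single_apply, hv]

theorem shift_single_one {v : H} (hv : V.starProjection v = v) :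
    V.shift (lp.single 2 1 v) = lp.single 2 0 v := by
  ext i
  rw [shift_apply]
  rcases i with _ | _ | i <;> simp [lp.single_apply, hv]

theorem norm_shift [Nontrivial H] : ‖V.shift‖ = 1 := by
  refine le_antisymm V.norm_shift_le ?_
  obtain ⟨x, hx, hn⟩ : ∃ x, x ≠ 0 ∧ ‖V.shift x‖ = ‖x‖ := by
    obtain ⟨v, hv⟩ := exists_ne (0 : H)
    have hs {w : H} (hw : w ≠ 0) (i : ℕ) : lp.single (E := fun _ : ℕ => H) 2 i w ≠ 0 := by
      rw [← norm_ne_zero_iff, lp.norm_single (by norm_num)]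
      exact norm_ne_zero_iff.2 hw
    by_cases hP : V.starProjection v = 0
    · exact ⟨_, hs hv 0, by rw [V.shift_single_zero hP]⟩
    · refine ⟨_, hs hP 1, ?_⟩
      rw [V.shift_single_one (V.starProjection_starProjection v), lp.norm_single (by norm_num),
        lp.norm_single (by norm_num)]
  have h := V.shift.le_opNorm x
  rw [hn] at h
  exact (le_mul_iff_one_le_left (norm_pos_iff.2 hx)).1 h

end Submodule

/-- For a closed subspace `V` of a Hilbert space `H`, the operator
`Shift(V)` on `H^∞ = ℓ²(ℕ, H)` is a well-defined bounded operator of norm at most `1`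
(of norm exactly `1` if `H ≠ {0}`), it is surjective, and its kernel consists of the
sequences `x` with `x 0 ∈ V` and `x i = 0` for all `i ≥ 1`. -/
theorem stmt_4 (𝕜 H : Type*) [RCLike 𝕜] [NormedAddCommGroup H] [InnerProductSpace 𝕜 H]
    [CompleteSpace H] (V : Submodule 𝕜 H) (hV : IsClosed (V : Set H)) :
    ∃ (P : H →L[𝕜] H) (T : lp (fun _ : ℕ => H) 2 →L[𝕜] lp (fun _ : ℕ => H) 2),
      ShiftRep 𝕜 V P T ∧ ‖T‖ ≤ 1 ∧ (Nontrivial H → ‖T‖ = 1) ∧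
        Function.Surjective T ∧
        ∀ x : lp (fun _ : ℕ => H) 2,
          T x = 0 ↔ (x 0 ∈ V ∧ ∀ i : ℕ, 1 ≤ i → x i = 0) := by
  have : CompleteSpace V := hV.completeSpace_coe
  exact ⟨V.starProjection, V.shift, ⟨V.isOrthProj_starProjection, V.shift_apply⟩,
    V.norm_shift_le, fun _ => V.norm_shift, V.shift_surjective, V.shift_eq_zero_iff⟩
end

section
/- Let 𝕜 be ℝ or ℂ, H a Hilbert space over 𝕜, and V, V' closed subspaces of H that are orthogonal to each other (⟨v, v'⟩ = 0 for all v ∈ V, v' ∈ V'). Then W := V + V' is a closed subspace of H, and Shift(W) = Shift(V) ∘ Shift(V') = Shift(V') ∘ Shift(V) as bounded operators on H^∞ = ℓ²(ℕ, H). -/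
namespace IsOrthProj

variable {𝕜 H : Type*} [RCLike 𝕜] [NormedAddCommGroup H] [InnerProductSpace 𝕜 H]
  {V W : Submodule 𝕜 H} {P Q : H →L[𝕜] H}

theorem eq_of_mem (hP : IsOrthProj 𝕜 W P) {u v : H} (hu : u ∈ W) (huv : v - u ∈ Wᗮ) :
    P v = u := by
  refine sub_eq_zero.mp (inner_self_eq_zero (𝕜 := 𝕜).mp ?_)
  have h : P v - u ∈ Wᗮ := by
    have := Wᗮ.sub_mem huv (hP.2.2 v)
    rwa [sub_sub_sub_cancel_left] at this
  exact h _ (W.sub_mem (hP.1 v) hu)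

theorem unique (hP : IsOrthProj 𝕜 W P) (hQ : IsOrthProj 𝕜 W Q) : P = Q :=
  ContinuousLinearMap.ext fun v => hP.eq_of_mem (hQ.1 v) (hQ.2.2 v)

theorem starProjection (W : Submodule 𝕜 H) [W.HasOrthogonalProjection] :
    IsOrthProj 𝕜 W W.starProjection :=
  ⟨W.starProjection_apply_mem, fun _ hv => Submodule.starProjection_eq_self_iff.mpr hv,
    W.sub_starProjection_mem_orthogonal⟩

theorem isClosed (hP : IsOrthProj 𝕜 W P) : IsClosed (W : Set H) := by
  have h : (W : Set H) = {v | P v = v} :=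
    Set.ext fun v => ⟨hP.2.1 v, fun hv => (show P v = v from hv) ▸ hP.1 v⟩
  rw [h]
  exact isClosed_eq P.continuous continuous_id

theorem apply_eq_zero (hP : IsOrthProj 𝕜 V P) (hVW : V ⟂ W) {v : H} (hv : v ∈ W) : P v = 0 :=
  hP.eq_of_mem V.zero_mem (by simpa using hVW.symm hv)

theorem sup (hP : IsOrthProj 𝕜 V P) (hQ : IsOrthProj 𝕜 W Q) (hVW : V ⟂ W) :
    IsOrthProj 𝕜 (V ⊔ W) (P + Q) := by
  refine ⟨fun v => Submodule.add_mem_sup (hP.1 v) (hQ.1 v), fun v hv => ?_, fun v => ?_⟩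
  · obtain ⟨a, ha, b, hb, rfl⟩ := Submodule.mem_sup.mp hv
    simp [hP.2.1 a ha, hQ.2.1 b hb, hP.apply_eq_zero hVW hb, hQ.apply_eq_zero hVW.symm ha]
  · rw [← Submodule.inf_orthogonal, add_apply]
    constructor
    · rw [← sub_sub]
      exact Vᗮ.sub_mem (hP.2.2 v) (hVW.symm (hQ.1 v))
    · rw [add_comm, ← sub_sub]
      exact Wᗮ.sub_mem (hQ.2.2 v) (hVW (hP.1 v))

end IsOrthProj

theorem ShiftRep.sup_eq_comp {𝕜 H : Type*} [RCLike 𝕜] [NormedAddCommGroup H]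
    [InnerProductSpace 𝕜 H] {V W : Submodule 𝕜 H} {P P₁ P₂ : H →L[𝕜] H}
    {T T₁ T₂ : lp (fun _ : ℕ => H) 2 →L[𝕜] lp (fun _ : ℕ => H) 2}
    (h : ShiftRep 𝕜 (V ⊔ W) P T) (h₁ : ShiftRep 𝕜 V P₁ T₁) (h₂ : ShiftRep 𝕜 W P₂ T₂)
    (hVW : V ⟂ W) : T = T₁.comp T₂ := by
  obtain rfl := h.1.unique (h₁.1.sup h₂.1 hVW)
  have h0 (v : H) : P₁ (P₂ v) = 0 := h₁.1.apply_eq_zero hVW (h₂.1.1 v)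
  ext x i
  simp only [ContinuousLinearMap.comp_apply, h.2, h₁.2, h₂.2, add_apply, map_add, map_sub, h0]
  abel


/-- If `V` and `V'` are mutually orthogonal closed subspaces of a
Hilbert space `H`, then `W = V + V'` is closed and
`Shift(W) = Shift(V) ∘ Shift(V') = Shift(V') ∘ Shift(V)` on `H^∞ = ℓ²(ℕ, H)`. -/
theorem stmt_5 (𝕜 H : Type*) [RCLike 𝕜] [NormedAddCommGroup H] [InnerProductSpace 𝕜 H]
    [CompleteSpace H] (V V' : Submodule 𝕜 H)
    (hV : IsClosed (V : Set H)) (hV' : IsClosed (V' : Set H))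
    (horth : ∀ v ∈ V, ∀ w ∈ V', @inner 𝕜 H _ v w = 0) :
    IsClosed ((V ⊔ V' : Submodule 𝕜 H) : Set H) ∧
    ∀ (P P₁ P₂ : H →L[𝕜] H)
      (T T₁ T₂ : lp (fun _ : ℕ => H) 2 →L[𝕜] lp (fun _ : ℕ => H) 2),
      ShiftRep 𝕜 (V ⊔ V') P T → ShiftRep 𝕜 V P₁ T₁ → ShiftRep 𝕜 V' P₂ T₂ →
      T = T₁.comp T₂ ∧ T = T₂.comp T₁ := by
  have hVW : V ⟂ V' := Submodule.isOrtho_iff_inner_eq.mpr horth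
  have := hV.completeSpace_coe
  have := hV'.completeSpace_coe
  refine ⟨((IsOrthProj.starProjection V).sup (IsOrthProj.starProjection V') hVW).isClosed,
    fun P P₁ P₂ T T₁ T₂ h h₁ h₂ => ⟨h.sup_eq_comp h₁ h₂ hVW, ?_⟩⟩
  rw [sup_comm] at h
  exact h.sup_eq_comp h₂ h₁ hVW.symm
end

section
/- Let 𝕜 be ℝ or ℂ, H a Hilbert space over 𝕜, V a closed subspace of H, and U : H → H a unitary operator (a surjective linear isometry). Let Ũ : H^∞ → H^∞ be the unitary operator induced componentwise on H^∞ = ℓ²(ℕ, H), i.e. (Ũx)_i = U(x_i). Then U(V) is a closed subspace of H and Shift(U(V)) = Ũ ∘ Shift(V) ∘ Ũ⁻¹. -/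
/-- The orthogonal projection onto a subspace is unique. -/
theorem IsOrthProj.unique_s6 {𝕜 H : Type*} [RCLike 𝕜] [NormedAddCommGroup H]
    [InnerProductSpace 𝕜 H] {W : Submodule 𝕜 H} {P Q : H →L[𝕜] H}
    (hP : IsOrthProj 𝕜 W P) (hQ : IsOrthProj 𝕜 W Q) : P = Q := by
  ext v
  have hmem : P v - Q v ∈ W := W.sub_mem (hP.1 v) (hQ.1 v)
  have horth : P v - Q v ∈ Wᗮ := by
    simpa using Wᗮ.sub_mem (hQ.2.2 v) (hP.2.2 v)
  exact sub_eq_zero.mp (Submodule.disjoint_def.mp W.orthogonal_disjoint _ hmem horth)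

/-- Conjugating the orthogonal projection onto `W` by a unitary `U` gives the orthogonal
projection onto `U(W)`. -/
theorem IsOrthProj.map {𝕜 H : Type*} [RCLike 𝕜] [NormedAddCommGroup H]
    [InnerProductSpace 𝕜 H] {W : Submodule 𝕜 H} {P : H →L[𝕜] H}
    (hP : IsOrthProj 𝕜 W P) (U : H ≃ₗᵢ[𝕜] H) :
    IsOrthProj 𝕜 (W.map (U.toLinearEquiv : H →ₗ[𝕜] H))
      ((U : H →L[𝕜] H).comp (P.comp (U.symm : H →L[𝕜] H))) := by
  refine ⟨fun v => ⟨P (U.symm v), hP.1 _, rfl⟩, ?_, fun v => ?_⟩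
  · rintro _ ⟨w, hw, rfl⟩
    simp [hP.2.1 w hw]
  · rw [Submodule.mem_orthogonal]
    rintro _ ⟨w, hw, rfl⟩
    have h := (Submodule.mem_orthogonal _ _).mp (hP.2.2 (U.symm v)) w hw
    rw [← U.inner_map_map] at h
    simpa using h

/-- For a unitary operator `U` on a Hilbert space `H` (a surjective
linear isometry) and a closed subspace `V`, the image `U(V)` is closed and
`Shift(U(V)) = Ũ ∘ Shift(V) ∘ Ũ⁻¹`, where `Ũ` is the operator induced
componentwise by `U` on `H^∞ = ℓ²(ℕ, H)`. -/
theorem stmt_6 (𝕜 H : Type*) [RCLike 𝕜] [NormedAddCommGroup H] [InnerProductSpace 𝕜 H]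
    [CompleteSpace H] (U : H ≃ₗᵢ[𝕜] H) (V : Submodule 𝕜 H)
    (hV : IsClosed (V : Set H)) :
    IsClosed ((V.map (U.toLinearEquiv : H →ₗ[𝕜] H) : Submodule 𝕜 H) : Set H) ∧
    ∀ (P P' : H →L[𝕜] H)
      (T T' Uinf Uinv : lp (fun _ : ℕ => H) 2 →L[𝕜] lp (fun _ : ℕ => H) 2),
      ShiftRep 𝕜 V P T →
      ShiftRep 𝕜 (V.map (U.toLinearEquiv : H →ₗ[𝕜] H)) P' T' →
      (∀ (x : lp (fun _ : ℕ => H) 2) (i : ℕ), (Uinf x) i = U (x i)) →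
      (∀ (x : lp (fun _ : ℕ => H) 2) (i : ℕ), (Uinv x) i = U.symm (x i)) →
      T' = Uinf.comp (T.comp Uinv) := by
  refine ⟨U.toHomeomorph.isClosedMap _ hV, ?_⟩
  intro P P' T T' Uinf Uinv hT hT' hUinf hUinv
  ext x i
  rw [hT'.1.unique_s6 (hT.1.map U)] at hT'
  simp [hT'.2, hT.2, hUinf, hUinv]
end

section
/- Let 𝕜 be ℝ or ℂ, H a Hilbert space over 𝕜, and V, W closed subspaces of H with orthogonal projections P_V and P_W. Then the operators Shift(V) and Shift(W) on H^∞ = ℓ²(ℕ, H) satisfy ‖Shift(V) − Shift(W)‖ ≤ 2‖P_V − P_W‖ in operator norm. In particular, the assignment V ↦ Shift(V) is continuous from the space of closed subspaces (metrized via the operator-norm distance of their orthogonal projections) to the bounded operators on H^∞ with the norm topology. -/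
/-- Partial sums of `‖x i‖ ^ 2` are bounded by the squared `ℓ²` norm. -/
theorem lp_two_sum_sq_le {ι E : Type*} [NormedAddCommGroup E]
    (x : lp (fun _ : ι => E) 2) (s : Finset ι) :
    ∑ i ∈ s, ‖x i‖ ^ 2 ≤ ‖x‖ ^ 2 := by
  simpa using lp.sum_rpow_le_norm_rpow (p := 2) (by norm_num) x s

/-- A vector of `ℓ²` all of whose coordinates are dominated by `c (‖x (i+1)‖ + ‖x i‖)` has norm
at most `2 c ‖x‖`. -/
theorem lp_two_norm_le_of_le_shift_add {E F : Type*} [NormedAddCommGroup E]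
    [NormedAddCommGroup F] (x : lp (fun _ : ℕ => E) 2) (y : lp (fun _ : ℕ => F) 2)
    {c : ℝ} (hc : 0 ≤ c) (h : ∀ i, ‖y i‖ ≤ c * (‖x (i + 1)‖ + ‖x i‖)) :
    ‖y‖ ≤ 2 * c * ‖x‖ := by
  have hC : 0 ≤ 2 * c * ‖x‖ := by positivity
  refine lp.norm_le_of_forall_sum_le (p := 2) (by norm_num) hC fun s => ?_
  have hshift : ∑ i ∈ s, ‖x (i + 1)‖ ^ 2 ≤ ‖x‖ ^ 2 := by
    simpa using lp_two_sum_sq_le x (s.map (addRightEmbedding 1))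
  have hsum : ∑ i ∈ s, ‖y i‖ ^ 2 ≤ (2 * c * ‖x‖) ^ 2 := calc
    ∑ i ∈ s, ‖y i‖ ^ 2 ≤ ∑ i ∈ s, 2 * c ^ 2 * (‖x (i + 1)‖ ^ 2 + ‖x i‖ ^ 2) := by
      refine Finset.sum_le_sum fun i _ => ?_
      calc ‖y i‖ ^ 2 ≤ (c * (‖x (i + 1)‖ + ‖x i‖)) ^ 2 := by gcongr; exact h i
        _ = c ^ 2 * (‖x (i + 1)‖ + ‖x i‖) ^ 2 := by ring
        _ ≤ c ^ 2 * (2 * (‖x (i + 1)‖ ^ 2 + ‖x i‖ ^ 2)) := by gcongr; exact add_sq_le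
        _ = 2 * c ^ 2 * (‖x (i + 1)‖ ^ 2 + ‖x i‖ ^ 2) := by ring
    _ = 2 * c ^ 2 * (∑ i ∈ s, ‖x (i + 1)‖ ^ 2 + ∑ i ∈ s, ‖x i‖ ^ 2) := by
      rw [← Finset.mul_sum, Finset.sum_add_distrib]
    _ ≤ 2 * c ^ 2 * (‖x‖ ^ 2 + ‖x‖ ^ 2) := by gcongr; exact lp_two_sum_sq_le x s
    _ = (2 * c * ‖x‖) ^ 2 := by ring
  simpa using hsum

theorem ShiftRep.norm_sub_le {𝕜 H : Type*} [RCLike 𝕜] [NormedAddCommGroup H]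
    [InnerProductSpace 𝕜 H] {V W : Submodule 𝕜 H} {PV PW : H →L[𝕜] H}
    {TV TW : lp (fun _ : ℕ => H) 2 →L[𝕜] lp (fun _ : ℕ => H) 2}
    (hV : ShiftRep 𝕜 V PV TV) (hW : ShiftRep 𝕜 W PW TW) :
    ‖TV - TW‖ ≤ 2 * ‖PV - PW‖ := by
  refine ContinuousLinearMap.opNorm_le_bound _ (by positivity) fun x => ?_
  refine lp_two_norm_le_of_le_shift_add x _ (norm_nonneg _) fun i => ?_
  have hi : ((TV - TW) x) i = (PV - PW) (x (i + 1) - x i) := by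
    rw [sub_apply, lp.coeFn_sub, Pi.sub_apply, hV.2, hW.2, map_sub, sub_apply, sub_apply]
    abel
  rw [hi]
  exact ((PV - PW).le_opNorm _).trans (by gcongr; exact _root_.norm_sub_le _ _)

/-- For closed subspaces `V`, `W` of a Hilbert space `H`, one has
`‖Shift(V) − Shift(W)‖ ≤ 2 ‖P_V − P_W‖`; in particular, `V ↦ Shift(V)` is continuous
from closed subspaces (metrized by the operator-norm distance of their orthogonal
projections) to bounded operators on `H^∞ = ℓ²(ℕ, H)` with the norm topology. -/
theorem stmt_8 (𝕜 H : Type*) [RCLike 𝕜] [NormedAddCommGroup H] [InnerProductSpace 𝕜 H]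
    [CompleteSpace H] :
    (∀ (V W : Submodule 𝕜 H), IsClosed (V : Set H) → IsClosed (W : Set H) →
      ∀ (PV PW : H →L[𝕜] H)
        (TV TW : lp (fun _ : ℕ => H) 2 →L[𝕜] lp (fun _ : ℕ => H) 2),
        ShiftRep 𝕜 V PV TV → ShiftRep 𝕜 W PW TW →
        ‖TV - TW‖ ≤ 2 * ‖PV - PW‖) ∧
    ∀ ε : ℝ, 0 < ε → ∃ δ : ℝ, 0 < δ ∧
      ∀ (V W : Submodule 𝕜 H), IsClosed (V : Set H) → IsClosed (W : Set H) →
      ∀ (PV PW : H →L[𝕜] H)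
        (TV TW : lp (fun _ : ℕ => H) 2 →L[𝕜] lp (fun _ : ℕ => H) 2),
        ShiftRep 𝕜 V PV TV → ShiftRep 𝕜 W PW TW →
        ‖PV - PW‖ < δ → ‖TV - TW‖ < ε := by
  refine ⟨fun V W _ _ PV PW TV TW hV hW => hV.norm_sub_le hW, fun ε hε =>
    ⟨ε / 2, by positivity, fun V W _ _ PV PW TV TW hV hW h => ?_⟩⟩
  linarith [hV.norm_sub_le hW]
end

section
/- Let E be a vector space over a field, and let E = E₁ ⊕ E₂ ⊕ E₃ be a direct sum decomposition of E into three subspaces. Let F be a subspace of E such that F = (F ∩ E₁) + (F ∩ (E₂ + E₃)) and F = (F ∩ (E₁ + E₂)) + (F ∩ E₃). Then F = (F ∩ E₁) + (F ∩ E₂) + (F ∩ E₃). -/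
/-- Let `E = E₁ ⊕ E₂ ⊕ E₃` be a direct-sum decomposition of a vector
space over a field, and let `F` be a subspace with `F = (F ∩ E₁) + (F ∩ (E₂ + E₃))` and
`F = (F ∩ (E₁ + E₂)) + (F ∩ E₃)`. Then `F = (F ∩ E₁) + (F ∩ E₂) + (F ∩ E₃)`. -/
theorem stmt_9 (K E : Type*) [Field K] [AddCommGroup E] [Module K E]
    (E₁ E₂ E₃ F : Submodule K E)
    (hsum : E₁ ⊔ E₂ ⊔ E₃ = ⊤)
    (hdisj₁ : Disjoint E₁ (E₂ ⊔ E₃)) (hdisj₂ : Disjoint E₂ E₃)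
    (hF1 : F = F ⊓ E₁ ⊔ F ⊓ (E₂ ⊔ E₃))
    (hF2 : F = F ⊓ (E₁ ⊔ E₂) ⊔ F ⊓ E₃) :
    F = F ⊓ E₁ ⊔ F ⊓ E₂ ⊔ F ⊓ E₃ := by
  refine le_antisymm (fun x hx => ?_) (sup_le (sup_le inf_le_left inf_le_left) inf_le_left)
  rw [hF1] at hx
  obtain ⟨a, ha, b, ⟨hbF, hb⟩, rfl⟩ := Submodule.mem_sup.1 hx
  rw [SetLike.mem_coe, hF2] at hbF
  obtain ⟨c, ⟨hcF, hc⟩, d, hd, rfl⟩ := Submodule.mem_sup.1 hbF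
  obtain ⟨u, hu, v, hv, rfl⟩ := Submodule.mem_sup.1 hc
  have hu' : u ∈ E₂ ⊔ E₃ := by
    have h := sub_mem hb (add_mem (Submodule.mem_sup_left hv) (Submodule.mem_sup_right hd.2))
    rwa [add_assoc, add_sub_cancel_right] at h
  obtain rfl : u = 0 := Submodule.disjoint_def.1 hdisj₁ u hu hu'
  rw [zero_add] at hcF ⊢
  rw [← add_assoc]
  exact Submodule.add_mem_sup (Submodule.add_mem_sup ha ⟨hcF, hv⟩) hd
end

section
/- Let 𝕜 be ℝ or ℂ, let n ≥ 1 and m ≥ 0 be integers, and for each k ∈ {0,…,m} let E_k be a finite-dimensional inner product space over 𝕜 with an orthogonal direct-sum decomposition E_k = E_k^{(1)} ⊕ ⋯ ⊕ E_k^{(n)} into n pairwise orthogonal subspaces. For p, q ≥ 1 with p + q = n, let V^{(p,q)} denote the set of all tuples B = (B_0,…,B_m), where each B_k is an orthonormal n-tuple of vectors of E_k, of the form B = C·M for some M in the unitary group U_n(𝕜) (acting diagonally on the right by (C·M)_k,j = Σ_{a=1}^n M_{a,j}(C_k)_a) and some tuple C with, for every k, the first p vectors of C_k lying in E_k^{(1)}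 ⊕ ⋯ ⊕ E_k^{(p)} and the last q vectors of C_k lying in E_k^{(p+1)} ⊕ ⋯ ⊕ E_k^{(n)}. Define V^{(p,q,r)} analogously for p, q, r ≥ 1 with p + q + r = n, using the three blocks E_k^{(1)} ⊕ ⋯ ⊕ E_k^{(p)}, E_k^{(p+1)} ⊕ ⋯ ⊕ E_k^{(p+q)}, E_k^{(p+q+1)} ⊕ ⋯ ⊕ E_k^{(n)}. Then for all p, q, p', q' ≥ 1 with p + q = p' + q' = n and p < p', one has V^{(p,q)} ∩ V^{(p',q')} = V^{(p, p'−p, q')}. -/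
/-- The span of the blocks `W k i` for `s ≤ i < t` inside `E k`. -/
def blockSpan (𝕜 : Type*) [RCLike 𝕜] {m n : ℕ} {E : Fin (m + 1) → Type*}
    [∀ k, NormedAddCommGroup (E k)] [∀ k, InnerProductSpace 𝕜 (E k)]
    (W : ∀ k, Fin n → Submodule 𝕜 (E k)) (k : Fin (m + 1)) (s t : ℕ) :
    Submodule 𝕜 (E k) :=
  ⨆ i : Fin n, ⨆ _ : s ≤ (i : ℕ) ∧ (i : ℕ) < t, W k i

/-- `V^{(p,q)}` (with `q = n - p`): tuples `B` of orthonormal `n`-tuples of the form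
`B = C · M` with `M` unitary and, for every `k`, the first `p` vectors of `C k` in the
span of the first `p` blocks and the last `n - p` vectors in the span of the
remaining blocks. -/
def VSplit2 (𝕜 : Type*) [RCLike 𝕜] {m n : ℕ} {E : Fin (m + 1) → Type*}
    [∀ k, NormedAddCommGroup (E k)] [∀ k, InnerProductSpace 𝕜 (E k)]
    (W : ∀ k, Fin n → Submodule 𝕜 (E k)) (p : ℕ) :
    Set (∀ k : Fin (m + 1), Fin n → E k) :=
  {B | (∀ k, Orthonormal 𝕜 (B k)) ∧
    ∃ M ∈ Matrix.unitaryGroup (Fin n) 𝕜, ∃ C : ∀ k : Fin (m + 1), Fin n → E k,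
      (∀ k, ∀ j : Fin n,
        ((j : ℕ) < p → C k j ∈ blockSpan 𝕜 W k 0 p) ∧
        (p ≤ (j : ℕ) → C k j ∈ blockSpan 𝕜 W k p n)) ∧
      ∀ k j, B k j = ∑ a : Fin n, M a j • C k a}

/-- `V^{(p₁, p₂ - p₁, n - p₂)}`: the analogous set with three blocks, split at `p₁`
and `p₂`. -/
def VSplit3 (𝕜 : Type*) [RCLike 𝕜] {m n : ℕ} {E : Fin (m + 1) → Type*}
    [∀ k, NormedAddCommGroup (E k)] [∀ k, InnerProductSpace 𝕜 (E k)]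
    (W : ∀ k, Fin n → Submodule 𝕜 (E k)) (p₁ p₂ : ℕ) :
    Set (∀ k : Fin (m + 1), Fin n → E k) :=
  {B | (∀ k, Orthonormal 𝕜 (B k)) ∧
    ∃ M ∈ Matrix.unitaryGroup (Fin n) 𝕜, ∃ C : ∀ k : Fin (m + 1), Fin n → E k,
      (∀ k, ∀ j : Fin n,
        ((j : ℕ) < p₁ → C k j ∈ blockSpan 𝕜 W k 0 p₁) ∧
        (p₁ ≤ (j : ℕ) → (j : ℕ) < p₂ → C k j ∈ blockSpan 𝕜 W k p₁ p₂) ∧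
        (p₂ ≤ (j : ℕ) → C k j ∈ blockSpan 𝕜 W k p₂ n)) ∧
      ∀ k j, B k j = ∑ a : Fin n, M a j • C k a}

/-- The diagonal right action of a matrix on an `n`-tuple of vectors. -/
def tupleMul {𝕜 ι F : Type*} [RCLike 𝕜] [Fintype ι] [AddCommGroup F] [Module 𝕜 F]
    (v : ι → F) (M : Matrix ι ι 𝕜) : ι → F :=
  fun j => ∑ a, M a j • v a

section tupleMul

variable {𝕜 ι F : Type*} [RCLike 𝕜] [Fintype ι]

theorem tupleMul_mul [AddCommGroup F] [Module 𝕜 F] (v : ι → F) (M N : Matrix ι ι 𝕜) :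
    tupleMul v (M * N) = tupleMul (tupleMul v M) N := by
  funext j
  simp only [tupleMul, Matrix.mul_apply, Finset.sum_smul, Finset.smul_sum, smul_smul]
  rw [Finset.sum_comm]
  simp only [mul_comm]

theorem tupleMul_one [DecidableEq ι] [AddCommGroup F] [Module 𝕜 F] (v : ι → F) :
    tupleMul v (1 : Matrix ι ι 𝕜) = v := by
  funext j
  simp [tupleMul, Matrix.one_apply, ite_smul]

theorem tupleMul_mem [AddCommGroup F] [Module 𝕜 F] {v : ι → F} {M : Matrix ι ι 𝕜} {j : ι}
    {S : Submodule 𝕜 F} (h : ∀ a, M a j ≠ 0 → v a ∈ S) : tupleMul v M j ∈ S := by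
  refine Submodule.sum_mem _ fun a _ => ?_
  by_cases ha : M a j = 0
  · simp [ha]
  · exact S.smul_mem _ (h a ha)

theorem conjTranspose_mul_apply_eq_inner (M N : Matrix ι ι 𝕜) (i j : ι) :
    (M.conjTranspose * N) i j =
      inner 𝕜 (WithLp.toLp 2 fun a => M a i : EuclideanSpace 𝕜 ι)
        (WithLp.toLp 2 fun a => N a j) := by
  simp [Matrix.mul_apply, PiLp.inner_apply, mul_comm]

theorem Orthonormal.tupleMul [DecidableEq ι] [NormedAddCommGroup F]
    [InnerProductSpace 𝕜 F] {v : ι → F}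
    (hv : Orthonormal 𝕜 v) {M : Matrix ι ι 𝕜} (hM : M ∈ Matrix.unitaryGroup ι 𝕜) :
    Orthonormal 𝕜 (tupleMul v M) := by
  rw [orthonormal_iff_ite]
  intro i j
  have h : (M.conjTranspose * M) i j = (1 : Matrix ι ι 𝕜) i j := by
    rw [← Matrix.star_eq_conjTranspose, Matrix.mem_unitaryGroup_iff'.1 hM]
  rw [Matrix.one_apply, Matrix.mul_apply] at h
  rw [← h]
  exact hv.inner_sum (fun a => M a i) (fun a => M a j) Finset.univ

theorem Orthonormal.inner_tupleMul [NormedAddCommGroup F] [InnerProductSpace 𝕜 F] {v : ι → F}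
    (hv : Orthonormal 𝕜 v) (M : Matrix ι ι 𝕜) (a j : ι) :
    inner 𝕜 (v a) (_root_.tupleMul v M j) = M a j :=
  hv.inner_right_fintype (fun a => M a j) a

end tupleMul

/-- If the columns of a unitary matrix `N` with index in `s` vanish in the rows in `r`, then the
standard basis vectors `e_a`, `a ∈ r`, together with those columns of `N` are columns
of a unitary matrix. -/
theorem exists_unitary_extending {𝕜 ι : Type*} [RCLike 𝕜] [Fintype ι] [DecidableEq ι]
    {N : Matrix ι ι 𝕜} (hN : N ∈ Matrix.unitaryGroup ι 𝕜) (r s : Set ι) (hrs : Disjoint r s)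
    (h0 : ∀ a ∈ r, ∀ j ∈ s, N a j = 0) :
    ∃ Q ∈ Matrix.unitaryGroup ι 𝕜, (∀ a, ∀ j ∈ r, Q a j = (1 : Matrix ι ι 𝕜) a j) ∧
      ∀ a, ∀ j ∈ s, Q a j = N a j := by
  classical
  let v : ι → EuclideanSpace 𝕜 ι := fun j =>
    if j ∈ r then EuclideanSpace.single j 1 else WithLp.toLp 2 fun a => N a j
  have hv : Orthonormal 𝕜 ((r ∪ s).domRestrict v) := by
    rw [orthonormal_iff_ite]
    rintro ⟨i, hi⟩ ⟨j, hj⟩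
    change inner 𝕜 (v i) (v j) = _
    simp only [Subtype.mk.injEq, v]
    by_cases hir : i ∈ r <;> by_cases hjr : j ∈ r
    · simp [hir, hjr, EuclideanSpace.inner_single_left]
    · have hij : i ≠ j := by rintro rfl; exact hjr hir
      simp [hir, hjr, hij, EuclideanSpace.inner_single_left,
        h0 i hir j (hj.resolve_left hjr)]
    · have hij : i ≠ j := by rintro rfl; exact hir hjr
      simp [hir, hjr, hij, EuclideanSpace.inner_single_right,
        h0 j hjr i (hi.resolve_left hir)]
    · rw [if_neg hir, if_neg hjr, ← conjTranspose_mul_apply_eq_inner,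
        ← Matrix.star_eq_conjTranspose, Matrix.mem_unitaryGroup_iff'.1 hN, Matrix.one_apply]
  obtain ⟨b, hb⟩ := hv.exists_orthonormalBasis_extension_of_card_eq (by simp)
  refine ⟨_, (EuclideanSpace.basisFun ι 𝕜).toMatrix_orthonormalBasis_mem_unitary b, ?_, ?_⟩
  · intro a j hj
    simp [Module.Basis.toMatrix_apply, hb j (Or.inl hj), v, hj, Matrix.one_apply]
  · intro a j hj
    simp [Module.Basis.toMatrix_apply, hb j (Or.inr hj), v, hrs.notMem_of_mem_right hj]

section blockSpan

variable {𝕜 : Type*} [RCLike 𝕜] {m n : ℕ} {E : Fin (m + 1) → Type*}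
  [∀ k, NormedAddCommGroup (E k)] [∀ k, InnerProductSpace 𝕜 (E k)]
  {W : ∀ k, Fin n → Submodule 𝕜 (E k)}

theorem blockSpan_mono (k : Fin (m + 1)) {s s' t t' : ℕ} (hs : s' ≤ s) (ht : t ≤ t') :
    blockSpan 𝕜 W k s t ≤ blockSpan 𝕜 W k s' t' :=
  iSup_mono fun _ => iSup_mono' fun h => ⟨⟨hs.trans h.1, h.2.trans_le ht⟩, le_rfl⟩

theorem blockSpan_isOrtho
    (horth : ∀ k, ∀ i j : Fin n, i ≠ j → ∀ v ∈ W k i, ∀ w ∈ W k j, @inner 𝕜 (E k) _ v w = 0)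
    (k : Fin (m + 1)) {s t s' t' : ℕ} (h : t ≤ s') :
    blockSpan 𝕜 W k s t ⟂ blockSpan 𝕜 W k s' t' := by
  simp only [blockSpan, Submodule.isOrtho_iSup_left, Submodule.isOrtho_iSup_right]
  intro i hi j hj
  exact Submodule.isOrtho_iff_inner_eq.2
    (horth k j i (by rintro rfl; omega))

theorem blockSpan_inf_le
    (horth : ∀ k, ∀ i j : Fin n, i ≠ j → ∀ v ∈ W k i, ∀ w ∈ W k j, @inner 𝕜 (E k) _ v w = 0)
    (k : Fin (m + 1)) {r s t u : ℕ} (htu : t ≤ u) :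
    blockSpan 𝕜 W k r t ⊓ blockSpan 𝕜 W k s u ≤ blockSpan 𝕜 W k s t := by
  have h1 : blockSpan 𝕜 W k r t ≤ blockSpan 𝕜 W k s t ⊔ blockSpan 𝕜 W k r s := by
    refine iSup₂_le fun i hi => ?_
    by_cases his : (i : ℕ) < s
    · exact le_sup_of_le_right (le_iSup₂_of_le i ⟨hi.1, his⟩ le_rfl)
    · exact le_sup_of_le_left (le_iSup₂_of_le i ⟨not_lt.1 his, hi.2⟩ le_rfl)
  refine (inf_le_inf_right _ h1).trans ?_
  rw [sup_inf_assoc_of_le _ (blockSpan_mono k le_rfl htu),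
    (blockSpan_isOrtho horth k le_rfl).disjoint.eq_bot, sup_bot_eq]

end blockSpan

/-- Let each `E k` (`k = 0, …, m`) be a finite-dimensional inner
product space decomposed as the orthogonal direct sum of `n` pairwise orthogonal
subspaces `W k i`. For `p + q = p' + q' = n` with `p, q, p', q' ≥ 1` and `p < p'`,
one has `V^{(p,q)} ∩ V^{(p',q')} = V^{(p, p'-p, q')}`. -/
theorem stmt_10 (𝕜 : Type*) [RCLike 𝕜] (m n : ℕ) (hn : 1 ≤ n)
    (E : Fin (m + 1) → Type*) [∀ k, NormedAddCommGroup (E k)]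
    [∀ k, InnerProductSpace 𝕜 (E k)] [∀ k, FiniteDimensional 𝕜 (E k)]
    (W : ∀ k, Fin n → Submodule 𝕜 (E k))
    (horth : ∀ k, ∀ i j : Fin n, i ≠ j →
      ∀ v ∈ W k i, ∀ w ∈ W k j, @inner 𝕜 (E k) _ v w = 0)
    (hspan : ∀ k, (⨆ i : Fin n, W k i) = ⊤)
    (p q p' q' : ℕ) (hp : 1 ≤ p) (hq : 1 ≤ q) (hp' : 1 ≤ p') (hq' : 1 ≤ q')
    (hpq : p + q = n) (hpq' : p' + q' = n) (hpp' : p < p') :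
    VSplit2 𝕜 W p ∩ VSplit2 𝕜 W p' = VSplit3 𝕜 W p p' := by
  apply Set.Subset.antisymm
  · rintro B ⟨⟨hB, M, hM, C, hC, hBC⟩, -, M', hM', D, hD, hBD⟩
    replace hBC : ∀ k, B k = tupleMul (C k) M := fun k => funext (hBC k)
    replace hBD : ∀ k, B k = tupleMul (D k) M' := fun k => funext (hBD k)
    have hCB : ∀ k, C k = tupleMul (B k) (star M) := fun k => by
      rw [hBC, ← tupleMul_mul, Matrix.mem_unitaryGroup_iff.1 hM, tupleMul_one]
    have hDB : ∀ k, D k = tupleMul (B k) (star M') := fun k => by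
      rw [hBD, ← tupleMul_mul, Matrix.mem_unitaryGroup_iff.1 hM', tupleMul_one]
    have hCo : ∀ k, Orthonormal 𝕜 (C k) := fun k => by
      rw [hCB]; exact (hB k).tupleMul (Unitary.star_mem hM)
    obtain ⟨N, hN, hDC⟩ : ∃ N ∈ Matrix.unitaryGroup (Fin n) 𝕜, ∀ k, D k = tupleMul (C k) N :=
      ⟨M * star M', mul_mem hM (Unitary.star_mem hM'), fun k => by
        rw [hDB, hBC, ← tupleMul_mul]⟩
    have h0 : ∀ a ∈ {a : Fin n | (a : ℕ) < p}, ∀ j ∈ {j : Fin n | p' ≤ (j : ℕ)}, N a j = 0 := by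
      intro a ha j hj
      rw [← (hCo 0).inner_tupleMul N a j, ← hDC]
      exact (blockSpan_isOrtho horth 0 hpp'.le).inner_eq ((hC 0 a).1 ha) ((hD 0 j).2 hj)
    obtain ⟨Q, hQ, hQ1, hQN⟩ := exists_unitary_extending hN _ _
      (Set.disjoint_left.2 fun a (ha : (a : ℕ) < p) (ha' : p' ≤ (a : ℕ)) => by omega) h0
    have hCQ : ∀ k, tupleMul (C k) Q = tupleMul (D k) (star N * Q) := fun k => by
      rw [hDC, ← tupleMul_mul, ← mul_assoc, Matrix.mem_unitaryGroup_iff.1 hN, one_mul]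
    refine ⟨hB, star Q * M, mul_mem (Unitary.star_mem hQ) hM, fun k => tupleMul (C k) Q,
      fun k j => ⟨fun hj => ?_, fun hj hj' => ?_, fun hj => ?_⟩, fun k j => ?_⟩
    · refine tupleMul_mem fun a ha => (hC k a).1 ?_
      rw [hQ1 a j hj] at ha
      obtain rfl : a = j := of_not_not fun haj => ha (Matrix.one_apply_ne haj)
      exact hj
    · refine blockSpan_inf_le horth k (r := 0) (u := n) (by omega) ⟨?_, ?_⟩
      · change tupleMul (C k) Q j ∈ _
        rw [hCQ]
        refine tupleMul_mem fun l hl => (hD k l).1 ?_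
        by_contra! hlp
        refine hl ?_
        have : (star N * Q) l j = (star Q * Q) l j := by
          simp only [Matrix.mul_apply, Matrix.star_apply, hQN _ l hlp]
        rw [this, Matrix.mem_unitaryGroup_iff'.1 hQ, Matrix.one_apply_ne]
        rintro rfl
        omega
      · refine tupleMul_mem fun a ha => (hC k a).2 ?_
        by_contra! hap
        refine ha ?_
        have : (star Q * Q) a j = Q a j := by
          simp [Matrix.mul_apply, Matrix.star_apply, hQ1 _ a hap, Matrix.one_apply]
        rw [← this, Matrix.mem_unitaryGroup_iff'.1 hQ, Matrix.one_apply_ne]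
        rintro rfl
        omega
    · have : tupleMul (C k) Q j = D k j := by
        rw [hDC]
        simp only [tupleMul, hQN _ j hj]
      change tupleMul (C k) Q j ∈ _
      exact this ▸ (hD k j).2 hj
    · change B k j = tupleMul (tupleMul (C k) Q) (star Q * M) j
      rw [← tupleMul_mul, ← mul_assoc, Matrix.mem_unitaryGroup_iff.1 hQ, one_mul, hBC]
  · rintro B ⟨hB, M, hM, C, hC, hBC⟩
    refine ⟨⟨hB, M, hM, C, fun k j => ⟨(hC k j).1, fun hj => ?_⟩, hBC⟩,
      ⟨hB, M, hM, C, fun k j => ⟨fun hj => ?_, (hC k j).2.2⟩, hBC⟩⟩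
    · rcases lt_or_ge (j : ℕ) p' with hj' | hj'
      · exact blockSpan_mono k le_rfl (by omega) ((hC k j).2.1 hj hj')
      · exact blockSpan_mono k hpp'.le le_rfl ((hC k j).2.2 hj')
    · rcases lt_or_ge (j : ℕ) p with hj' | hj'
      · exact blockSpan_mono k le_rfl hpp'.le ((hC k j).1 hj')
      · exact blockSpan_mono k (Nat.zero_le _) le_rfl ((hC k j).2.1 hj' hj)
end

section
/- Let σ : Fin(n+1) → Fin(k+1) be a monotone surjection. For each i ∈ Fin(k+1) the fiber σ⁻¹{i} is a nonempty finite set; let Δ(σ⁻¹{i}) denote the standard simplex of probability vectors indexed by σ⁻¹{i}. Define λ_σ : (∏_{i} Δ(σ⁻¹{i})) × Δᵏ → Δⁿ by λ_σ(x, t)(j) = t(σ(j)) · x_{σ(j)}(j). Then λ_σ is well defined (its values lie in Δⁿ), continuous, and surjective; moreover, if 0 < k < n then λ_σ is not injective. -/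
/-- The map `λ_σ : (∏_i Δ(σ⁻¹{i})) × Δᵏ → ℝ^{n+1}`, given by
`λ_σ(x, t)(j) = t (σ j) * x_{σ j} (j)`. -/
noncomputable def lambdaMap (n k : ℕ) (σ : Fin (n + 1) → Fin (k + 1))
    (z : (∀ i : Fin (k + 1), stdSimplex ℝ {j : Fin (n + 1) // σ j = i}) ×
      stdSimplex ℝ (Fin (k + 1))) :
    Fin (n + 1) → ℝ :=
  fun j => (z.2 : Fin (k + 1) → ℝ) (σ j) *
    (z.1 (σ j) : {j' : Fin (n + 1) // σ j' = σ j} → ℝ) ⟨j, rfl⟩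

theorem lambdaMap_apply {n k : ℕ} {σ : Fin (n + 1) → Fin (k + 1)}
    (z : (∀ i : Fin (k + 1), stdSimplex ℝ {j : Fin (n + 1) // σ j = i}) ×
      stdSimplex ℝ (Fin (k + 1))) {i : Fin (k + 1)} (j : {j : Fin (n + 1) // σ j = i}) :
    lambdaMap n k σ z j = (z.2 : Fin (k + 1) → ℝ) i *
      (z.1 i : {j : Fin (n + 1) // σ j = i} → ℝ) j := by
  obtain ⟨j, rfl⟩ := j
  rfl

theorem lambdaMap_mem_stdSimplex {n k : ℕ} {σ : Fin (n + 1) → Fin (k + 1)}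
    (z : (∀ i : Fin (k + 1), stdSimplex ℝ {j : Fin (n + 1) // σ j = i}) ×
      stdSimplex ℝ (Fin (k + 1))) :
    lambdaMap n k σ z ∈ stdSimplex ℝ (Fin (n + 1)) := by
  refine ⟨fun j => mul_nonneg (z.2.2.1 _) ((z.1 (σ j)).2.1 _), ?_⟩
  rw [← Fintype.sum_fiberwise σ]
  calc ∑ i, ∑ j : {j // σ j = i}, lambdaMap n k σ z j
      = ∑ i, (z.2 : Fin (k + 1) → ℝ) i := by
        refine Finset.sum_congr rfl fun i _ => ?_
        simp_rw [lambdaMap_apply]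
        rw [← Finset.mul_sum]
        exact (congrArg _ (z.1 i).2.2).trans (mul_one _)
    _ = 1 := z.2.2.2

theorem continuous_lambdaMap (n k : ℕ) (σ : Fin (n + 1) → Fin (k + 1)) :
    Continuous (lambdaMap n k σ) := by
  refine continuous_pi fun j => Continuous.mul ?_ ?_
  · exact (continuous_apply (σ j)).comp (continuous_subtype_val.comp continuous_snd)
  · exact (continuous_apply (⟨j, rfl⟩ : {j' // σ j' = σ j})).comp
      (continuous_subtype_val.comp ((continuous_apply (σ j)).comp continuous_fst))

/-- A nonnegative vector on a nonempty finite type is its total mass times a probability vector. -/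
theorem exists_stdSimplex_sum_mul_eq {ι : Type*} [Fintype ι] [Nonempty ι] (y : ι → ℝ)
    (hy : ∀ j, 0 ≤ y j) : ∃ x : stdSimplex ℝ ι, ∀ j, (∑ j', y j') * (x : ι → ℝ) j = y j := by
  classical
  by_cases h : ∑ j', y j' = 0
  · refine ⟨⟨_, single_mem_stdSimplex ℝ (Classical.arbitrary ι)⟩, fun j => ?_⟩
    rw [h, zero_mul, (Finset.sum_eq_zero_iff_of_nonneg fun j _ => hy j).1 h j (Finset.mem_univ j)]
  · refine ⟨⟨fun j => y j / ∑ j', y j',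
      fun j => div_nonneg (hy j) (Finset.sum_nonneg fun j _ => hy j), ?_⟩,
      fun j => mul_div_cancel₀ _ h⟩
    rw [← Finset.sum_div, div_self h]

theorem exists_lambdaMap_eq {n k : ℕ} {σ : Fin (n + 1) → Fin (k + 1)}
    (hsurj : Function.Surjective σ) {y : Fin (n + 1) → ℝ} (hy : y ∈ stdSimplex ℝ (Fin (n + 1))) :
    ∃ z, lambdaMap n k σ z = y := by
  have hne (i : Fin (k + 1)) : Nonempty {j : Fin (n + 1) // σ j = i} := nonempty_subtype.2 (hsurj i)
  choose x hx using fun i => exists_stdSimplex_sum_mul_eq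
    (fun j : {j : Fin (n + 1) // σ j = i} => y j) fun j => hy.1 j
  refine ⟨(x, ⟨fun i => ∑ j : {j : Fin (n + 1) // σ j = i}, y j,
    fun i => Finset.sum_nonneg fun j _ => hy.1 j, ?_⟩), ?_⟩
  · rw [Fintype.sum_fiberwise σ, hy.2]
  · funext j
    exact hx (σ j) ⟨j, rfl⟩

theorem not_injective_lambdaMap {n k : ℕ} {σ : Fin (n + 1) → Fin (k + 1)}
    (hsurj : Function.Surjective σ) (hk : 0 < k) (hkn : k < n) :
    ¬ Function.Injective (lambdaMap n k σ) := by
  intro hinj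
  have hne (i : Fin (k + 1)) : Nonempty {j : Fin (n + 1) // σ j = i} := nonempty_subtype.2 (hsurj i)
  obtain ⟨a, b, hab, hσ⟩ := Fintype.exists_ne_map_eq_of_card_lt σ (by simpa using hkn)
  have : Nontrivial (Fin (k + 1)) := Fin.nontrivial_iff_two_le.2 (by omega)
  obtain ⟨i', hi'⟩ := exists_ne (σ b)
  let vertex (i : Fin (k + 1)) (j : {j : Fin (n + 1) // σ j = i}) :
      stdSimplex ℝ {j : Fin (n + 1) // σ j = i} := ⟨_, single_mem_stdSimplex ℝ j⟩
  let x (i : Fin (k + 1)) := vertex i (Classical.arbitrary _)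
  let t : stdSimplex ℝ (Fin (k + 1)) := ⟨_, single_mem_stdSimplex ℝ i'⟩
  have key : lambdaMap n k σ (Function.update x (σ b) (vertex (σ b) ⟨a, hσ⟩), t) =
      lambdaMap n k σ (Function.update x (σ b) (vertex (σ b) ⟨b, rfl⟩), t) := by
    funext j
    by_cases hj : σ j = σ b
    · have ht : (t : Fin (k + 1) → ℝ) (σ j) = 0 := Pi.single_eq_of_ne (hj ▸ hi'.symm) 1
      simp only [lambdaMap, ht, zero_mul]
    · simp only [lambdaMap, Function.update_of_ne hj]
  have hv := congrFun (congrArg Prod.fst (hinj key)) (σ b)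
  simp only [Function.update_self] at hv
  have h1 := congrFun (congrArg Subtype.val hv) ⟨a, hσ⟩
  simp [vertex, hab] at h1

/-- For a monotone surjection `σ : Fin (n+1) → Fin (k+1)`, all fibers
are nonempty, the map `λ_σ` takes values in the standard simplex `Δⁿ`, is continuous
and surjective onto `Δⁿ`, and is not injective whenever `0 < k < n`. -/
theorem stmt_11 (n k : ℕ) (σ : Fin (n + 1) → Fin (k + 1))
    (hmono : Monotone σ) (hsurj : Function.Surjective σ) :
    (∀ i : Fin (k + 1), Nonempty {j : Fin (n + 1) // σ j = i}) ∧
    (∀ z, lambdaMap n k σ z ∈ stdSimplex ℝ (Fin (n + 1))) ∧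
    Continuous (lambdaMap n k σ) ∧
    (∀ y ∈ stdSimplex ℝ (Fin (n + 1)), ∃ z, lambdaMap n k σ z = y) ∧
    (0 < k → k < n → ¬ Function.Injective (lambdaMap n k σ)) := by
  exact ⟨fun i => nonempty_subtype.2 (hsurj i), lambdaMap_mem_stdSimplex,
    continuous_lambdaMap n k σ, fun _ hy => exists_lambdaMap_eq hsurj hy,
    not_injective_lambdaMap hsurj⟩
end

section
/- Let σ : Fin(n+1) → Fin(k+1) be a monotone surjection. Consider the space T = Σ_{(m,δ)} (∏_{i ∈ Fin(m+1)} Δ(σ⁻¹{δ(i)})) × Δᵐ, where the sum ranges over all pairs of a natural number m and a monotone injection δ : Fin(m+1) → Fin(k+1). Let ∼ be the equivalence relation on T generated by the following elementary relations: whenever δ'' : Fin(m+1) → Fin(m'+1) and δ' : Fin(m'+1) → Fin(k+1) are monotone injections, δ = δ' ∘ δ'', x ∈ ∏_{i ∈ Fin(m'+1)} Δ(σ⁻¹{δ'(i)}) and t ∈ Δᵐ, the point ((m, δ), (x_{δ''(i)})_{i ∈ Fin(m+1)}, t) is identified with ((m', δ'), x, δ''_#(t)), where δ''_#(t) ∈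 Δ^{m'} is the pushforward given by δ''_#(t)(i') = Σ_{δ''(i) = i'} t(i). Define ν_σ : T → Δⁿ by ν_σ((m,δ), x, t)(j) = t(i)·x_i(j) if σ(j) = δ(i) for some i ∈ Fin(m+1), and ν_σ((m,δ), x, t)(j) = 0 if σ(j) is not in the range of δ. Then ν_σ is constant on ∼-equivalence classes, and the induced map from the quotient space T/∼ (with the quotient topology) to Δⁿ is a homeomorphism. -/
/-- Index pairs `(m, δ)` with `δ : Fin (m+1) → Fin (k+1)` a monotone injection. -/
def IndexCat (k : ℕ) : Type :=
  Σ m : ℕ, {δ : Fin (m + 1) → Fin (k + 1) // Monotone δ ∧ Function.Injective δ}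

/-- The total space `T = Σ_{(m,δ)} (∏_{i} Δ(σ⁻¹{δ i})) × Δᵐ` (disjoint-union
topology, each summand with its product/subspace topology). -/
abbrev TSpace (n k : ℕ) (σ : Fin (n + 1) → Fin (k + 1)) : Type :=
  Σ p : IndexCat k,
    (∀ i : Fin (p.1 + 1), stdSimplex ℝ {j : Fin (n + 1) // σ j = p.2.1 i}) ×
      stdSimplex ℝ (Fin (p.1 + 1))

/-- The map `ν_σ : T → ℝ^{n+1}`: for `z = ((m, δ), x, t)`,
`ν_σ(z)(j) = t i * x i j` if `δ i = σ j` for (the unique) `i`, and `0` if `σ j` is not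
in the range of `δ`. -/
noncomputable def nuMap (n k : ℕ) (σ : Fin (n + 1) → Fin (k + 1))
    (z : TSpace n k σ) : Fin (n + 1) → ℝ :=
  fun j => ∑ i : Fin (z.1.1 + 1),
    if h : z.1.2.1 i = σ j then (z.2.2).1 i * (z.2.1 i).1 ⟨j, h.symm⟩ else 0

/-- The elementary relations generating the equivalence relation `∼` on `T`:
for monotone injections `δ'' : Fin (m+1) → Fin (m'+1)` and
`δ' : Fin (m'+1) → Fin (k+1)`, the point `((m, δ' ∘ δ''), (x_{δ'' i})_i, t)` is
identified with `((m', δ'), x, δ''_# t)`, where `δ''_#` is the pushforward of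
probability vectors. -/
def TRel (n k : ℕ) (σ : Fin (n + 1) → Fin (k + 1)) (a b : TSpace n k σ) : Prop :=
  ∃ δ'' : Fin (a.1.1 + 1) → Fin (b.1.1 + 1),
    Monotone δ'' ∧ Function.Injective δ'' ∧
    (∀ i, b.1.2.1 (δ'' i) = a.1.2.1 i) ∧
    (∀ (i : Fin (a.1.1 + 1)) (j : Fin (n + 1)) (h : σ j = a.1.2.1 i)
      (h' : σ j = b.1.2.1 (δ'' i)),
      (a.2.1 i).1 ⟨j, h⟩ = (b.2.1 (δ'' i)).1 ⟨j, h'⟩) ∧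
    (∀ i' : Fin (b.1.1 + 1),
      (b.2.2).1 i' = ∑ i : Fin (a.1.1 + 1), if δ'' i = i' then (a.2.2).1 i else 0)

theorem finite_indexCat (k : ℕ) : Finite (IndexCat k) := by
  let f : (Σ m : Fin (k + 1),
      {δ : Fin (m.1 + 1) → Fin (k + 1) // Monotone δ ∧ Function.Injective δ}) → IndexCat k :=
    fun p => ⟨p.1.1, p.2⟩
  refine Finite.of_surjective f ?_
  rintro ⟨m, δ⟩
  have h : m + 1 ≤ k + 1 := by
    simpa using Fintype.card_le_of_injective δ.1 δ.2.2
  exact ⟨⟨⟨m, by omega⟩, δ⟩, rfl⟩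

section

variable {n k : ℕ} {σ : Fin (n + 1) → Fin (k + 1)}

theorem sum_fiber_dite {c : Fin (k + 1)} (f : {j : Fin (n + 1) // σ j = c} → ℝ) :
    ∑ j, (if h : c = σ j then f ⟨j, h.symm⟩ else 0) = ∑ j, f j := by
  refine (Fintype.sum_of_injective Subtype.val Subtype.val_injective _ _ ?_ ?_).symm
  · intro j hj
    exact dif_neg fun h => hj ⟨⟨j, h.symm⟩, rfl⟩
  · intro j
    rw [dif_pos j.2.symm]

/-- On the fiber over `δ i`, the value of `ν_σ` is `t i * x i`. -/
theorem nuMap_eq_mul (z : TSpace n k σ) (i : Fin (z.1.1 + 1)) (j : Fin (n + 1))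
    (h : σ j = z.1.2.1 i) : nuMap n k σ z j = (z.2.2).1 i * (z.2.1 i).1 ⟨j, h⟩ := by
  unfold nuMap
  rw [Finset.sum_eq_single i, dif_pos h.symm]
  · intro i' _ hi'
    exact dif_neg fun h' => hi' (z.1.2.2.2 (h'.trans h))
  · simp

theorem nuMap_nonneg (z : TSpace n k σ) (j : Fin (n + 1)) : 0 ≤ nuMap n k σ z j := by
  refine Finset.sum_nonneg fun i _ => ?_
  split_ifs with h
  · exact mul_nonneg (z.2.2.2.1 i) ((z.2.1 i).2.1 _)
  · exact le_rfl

/-- The mass that `ν_σ z` puts on the fiber over `c`. -/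
theorem sum_fiber_nuMap (z : TSpace n k σ) (c : Fin (k + 1)) :
    ∑ j, (if σ j = c then nuMap n k σ z j else 0) =
      ∑ i, if z.1.2.1 i = c then (z.2.2).1 i else 0 := by
  have h1 : ∀ j, (if σ j = c then nuMap n k σ z j else 0) =
      ∑ i, if z.1.2.1 i = c then
        (z.2.2).1 i * (if h : z.1.2.1 i = σ j then (z.2.1 i).1 ⟨j, h.symm⟩ else 0) else 0 := by
    intro j
    by_cases hj : σ j = c
    · rw [if_pos hj]
      refine Finset.sum_congr rfl fun i _ => ?_
      by_cases hi : z.1.2.1 i = σ j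
      · rw [dif_pos hi, if_pos (hi.trans hj), dif_pos hi]
      · simp [hi]
    · rw [if_neg hj, Finset.sum_eq_zero]
      intro i _
      by_cases hi : z.1.2.1 i = c
      · have : z.1.2.1 i ≠ σ j := fun h => hj (h.symm.trans hi)
        simp [this]
      · simp [hi]
  simp_rw [h1]
  rw [Finset.sum_comm]
  refine Finset.sum_congr rfl fun i _ => ?_
  by_cases hi : z.1.2.1 i = c
  · simp only [if_pos hi]
    rw [← Finset.mul_sum, sum_fiber_dite, (z.2.1 i).2.2, mul_one]
  · simp [hi]

theorem sum_fiber_nuMap_apply (z : TSpace n k σ) (i : Fin (z.1.1 + 1)) :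
    ∑ j, (if σ j = z.1.2.1 i then nuMap n k σ z j else 0) = (z.2.2).1 i := by
  rw [sum_fiber_nuMap, Finset.sum_eq_single i]
  · simp
  · intro i' _ hi'
    exact if_neg fun h => hi' (z.1.2.2.2 h)
  · simp

theorem nuMap_mem_stdSimplex (z : TSpace n k σ) :
    nuMap n k σ z ∈ stdSimplex ℝ (Fin (n + 1)) := by
  refine ⟨nuMap_nonneg z, ?_⟩
  have h : ∀ j, nuMap n k σ z j = ∑ c, if σ j = c then nuMap n k σ z j else 0 := by
    intro j
    simp
  rw [Finset.sum_congr rfl fun j _ => h j, Finset.sum_comm]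
  simp_rw [sum_fiber_nuMap]
  rw [Finset.sum_comm]
  simpa using z.2.2.2.2

theorem TRel.nuMap_eq {a b : TSpace n k σ} (h : TRel n k σ a b) :
    nuMap n k σ a = nuMap n k σ b := by
  obtain ⟨δ, -, hinj, hδ, hx, ht⟩ := h
  have ht' : ∀ i, (b.2.2).1 (δ i) = (a.2.2).1 i := by
    intro i
    rw [ht, Finset.sum_eq_single i]
    · simp
    · intro i' _ hi'
      exact if_neg fun h => hi' (hinj h)
    · simp
  funext j
  by_cases hj : ∃ i, σ j = a.1.2.1 i
  · obtain ⟨i, hi⟩ := hj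
    have hi' : σ j = b.1.2.1 (δ i) := hi.trans (hδ i).symm
    rw [nuMap_eq_mul a i j hi, nuMap_eq_mul b (δ i) j hi', ht', hx i j hi hi']
  · push Not at hj
    have ha : nuMap n k σ a j = 0 :=
      Finset.sum_eq_zero fun i _ => dif_neg (hj i).symm
    by_cases hjb : ∃ i', σ j = b.1.2.1 i'
    · obtain ⟨i', hi'⟩ := hjb
      rw [ha, nuMap_eq_mul b i' j hi', ht, Finset.sum_eq_zero, zero_mul]
      intro i _
      refine if_neg fun h => hj i ?_
      rw [hi', ← h, hδ]
    · push Not at hjb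
      rw [ha]
      exact (Finset.sum_eq_zero fun i _ => dif_neg (hjb i).symm).symm

/-- A point whose simplex coordinates are all positive is related to every point with the
same image under `ν_σ`. -/
theorem TRel.of_nuMap_eq {a b : TSpace n k σ} (hpos : ∀ i, 0 < (a.2.2).1 i)
    (hab : nuMap n k σ a = nuMap n k σ b) : TRel n k σ a b := by
  have hex : ∀ i, ∃ i', b.1.2.1 i' = a.1.2.1 i := by
    intro i
    by_contra! hne
    have h := sum_fiber_nuMap_apply a i
    rw [hab, sum_fiber_nuMap, Finset.sum_eq_zero fun i' _ => if_neg (hne i')] at h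
    exact (hpos i).ne h
  choose δ hδ using hex
  have hinj : Function.Injective δ := fun i i' h =>
    a.1.2.2.2 (by rw [← hδ, ← hδ, h])
  have hb : StrictMono b.1.2.1 := b.1.2.2.1.strictMono_of_injective b.1.2.2.2
  have ht : ∀ i, (b.2.2).1 (δ i) = (a.2.2).1 i := by
    intro i
    rw [← sum_fiber_nuMap_apply a, ← sum_fiber_nuMap_apply b, hab, hδ]
  refine ⟨δ, ?_, hinj, hδ, ?_, ?_⟩
  · intro i i' h
    rw [← hb.le_iff_le, hδ, hδ]
    exact a.1.2.2.1 h
  · intro i j h h'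
    have := congrFun hab j
    rw [nuMap_eq_mul a i j h, nuMap_eq_mul b (δ i) j h', ht] at this
    exact mul_left_cancel₀ (hpos i).ne' this
  · intro i'
    rw [← sum_fiber_nuMap_apply b, ← hab, sum_fiber_nuMap]
    refine Finset.sum_congr rfl fun i _ => ?_
    simp only [← hδ, b.1.2.2.2.eq_iff]

/-- Every point is the target of an elementary relation from a point all of whose simplex
coordinates are positive. -/
theorem TRel.exists_pos (a : TSpace n k σ) :
    ∃ a₀ : TSpace n k σ, TRel n k σ a₀ a ∧ ∀ i, 0 < (a₀.2.2).1 i := by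
  obtain ⟨⟨m, δ, hmon, hinj⟩, x, t⟩ := a
  let S : Finset (Fin (m + 1)) := Finset.univ.filter fun i => 0 < t.1 i
  have hS : S.Nonempty := by
    by_contra hne
    have h0 : ∀ i, t.1 i = 0 := by
      intro i
      refine le_antisymm (not_lt.1 fun hi => hne ⟨i, ?_⟩) (t.2.1 i)
      simpa [S] using hi
    have h1 := t.2.2
    rw [Finset.sum_eq_zero fun i _ => h0 i] at h1
    exact zero_ne_one h1
  have hcard : S.card = (S.card - 1) + 1 := (Nat.sub_add_cancel hS.card_pos).symm
  let e := S.orderEmbOfFin hcard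
  have hsum : ∀ f : Fin (m + 1) → ℝ, ∑ i, f (e i) = ∑ i ∈ S, f i := by
    intro f
    calc ∑ i, f (e i) = ∑ i ∈ Finset.univ.map e.toEmbedding, f i :=
          (Finset.sum_map _ _ _).symm
      _ = ∑ i ∈ S, f i := by rw [Finset.map_orderEmbOfFin_univ S hcard]
  have hpos : ∀ i, 0 < t.1 (e i) := by
    intro i
    exact (Finset.mem_filter.1 (S.orderEmbOfFin_mem hcard i)).2
  have hzero : ∀ i, i ∉ S → t.1 i = 0 := by
    intro i hi
    refine le_antisymm (not_lt.1 fun h => hi ?_) (t.2.1 i)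
    simpa [S] using h
  refine ⟨⟨⟨S.card - 1, δ ∘ e, hmon.comp e.monotone, hinj.comp e.injective⟩,
    fun i => x (e i), ⟨fun i => t.1 (e i), fun i => (hpos i).le, ?_⟩⟩, ?_, hpos⟩
  · rw [hsum t.1, ← t.2.2]
    exact Finset.sum_subset (Finset.subset_univ S) fun i _ hi => hzero i hi
  · refine ⟨e, e.monotone, e.injective, fun _ => rfl, fun _ _ _ _ => rfl, fun i' => ?_⟩
    change t.1 i' = ∑ i, if e i = i' then t.1 (e i) else 0
    rw [hsum fun i => if i = i' then t.1 i else 0, Finset.sum_ite_eq']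
    split_ifs with h
    · rfl
    · exact hzero i' h

theorem exists_nuMap_eq (hsurj : Function.Surjective σ) {y : Fin (n + 1) → ℝ}
    (hy : y ∈ stdSimplex ℝ (Fin (n + 1))) : ∃ z : TSpace n k σ, nuMap n k σ z = y := by
  let t : Fin (k + 1) → ℝ := fun c => ∑ j : {j // σ j = c}, y j
  have ht : ∀ c, 0 ≤ t c := fun c => Finset.sum_nonneg fun j _ => hy.1 j
  have hx : ∀ c, ∃ x : stdSimplex ℝ {j : Fin (n + 1) // σ j = c},
      ∀ j, t c * x.1 j = y j := by
    intro c
    obtain ⟨j₀, hj₀⟩ := hsurj c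
    rcases (ht c).eq_or_lt with h | h
    · refine ⟨⟨Pi.single ⟨j₀, hj₀⟩ 1, single_mem_stdSimplex ℝ _⟩, fun j => ?_⟩
      have := (Finset.sum_eq_zero_iff_of_nonneg fun j _ => hy.1 _).1 h.symm j (Finset.mem_univ j)
      rw [← h, zero_mul, this]
    · refine ⟨⟨fun j => y j / t c, fun j => div_nonneg (hy.1 j) h.le, ?_⟩,
        fun j => mul_div_cancel₀ _ h.ne'⟩
      rw [← Finset.sum_div]
      exact div_self h.ne'
  choose x hx using hx
  have hsum : ∑ c, t c = 1 := by
    rw [← hy.2]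
    exact Fintype.sum_fiberwise σ y
  refine ⟨⟨⟨k, id, monotone_id, Function.injective_id⟩, x, ⟨t, ht, hsum⟩⟩, ?_⟩
  funext j
  rw [nuMap_eq_mul _ (σ j) j rfl]
  exact hx (σ j) ⟨j, rfl⟩

theorem continuous_nuMap_summand {m : ℕ} {δ : Fin (m + 1) → Fin (k + 1)} (i : Fin (m + 1))
    (j : Fin (n + 1)) :
    Continuous fun a : (∀ i, stdSimplex ℝ {j : Fin (n + 1) // σ j = δ i}) ×
      stdSimplex ℝ (Fin (m + 1)) =>
        if h : δ i = σ j then a.2.1 i * (a.1 i).1 ⟨j, h.symm⟩ else 0 := by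
  by_cases h : δ i = σ j
  · simp only [dif_pos h]
    exact ((continuous_apply i).comp (continuous_subtype_val.comp continuous_snd)).mul
      ((continuous_apply (⟨j, h.symm⟩ : {j // σ j = δ i})).comp (continuous_subtype_val.comp
        ((continuous_apply i).comp continuous_fst)))
  · simp only [dif_neg h]
    exact continuous_const

theorem continuous_nuMap : Continuous (nuMap n k σ) :=
  continuous_sigma fun p => continuous_pi fun j =>
    continuous_finsetSum Finset.univ fun i _ =>
      continuous_nuMap_summand (δ := p.2.1) i j

end

/-- For a monotone surjection `σ : Fin (n+1) → Fin (k+1)`, the map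
`ν_σ` takes values in the standard simplex `Δⁿ`, is constant on the equivalence
classes of the relation generated by the elementary relations `TRel`, and the induced
map from the quotient space `T/∼` to `Δⁿ` is a homeomorphism. -/
theorem stmt_12 (n k : ℕ) (σ : Fin (n + 1) → Fin (k + 1))
    (hmono : Monotone σ) (hsurj : Function.Surjective σ) :
    (∀ z : TSpace n k σ, nuMap n k σ z ∈ stdSimplex ℝ (Fin (n + 1))) ∧
    (∀ a b : TSpace n k σ, TRel n k σ a b → nuMap n k σ a = nuMap n k σ b) ∧
    ∃ e : Quot (TRel n k σ) ≃ₜ stdSimplex ℝ (Fin (n + 1)),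
      ∀ z : TSpace n k σ,
        ((e (Quot.mk _ z) : stdSimplex ℝ (Fin (n + 1))) : Fin (n + 1) → ℝ)
          = nuMap n k σ z := by
  refine ⟨nuMap_mem_stdSimplex, fun a b => TRel.nuMap_eq, ?_⟩
  have := finite_indexCat k
  let f : Quot (TRel n k σ) → stdSimplex ℝ (Fin (n + 1)) :=
    Quot.lift (fun z => ⟨nuMap n k σ z, nuMap_mem_stdSimplex z⟩)
      fun a b h => Subtype.ext h.nuMap_eq
  have hf : Continuous f :=
    continuous_coinduced_dom.2 (continuous_nuMap.subtype_mk nuMap_mem_stdSimplex)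
  have hinj : Function.Injective f := by
    rintro ⟨a⟩ ⟨b⟩ h
    have hab : nuMap n k σ a = nuMap n k σ b := congrArg Subtype.val h
    obtain ⟨a₀, ha, hpos⟩ := TRel.exists_pos a
    exact (Quot.sound ha).symm.trans
      (Quot.sound (TRel.of_nuMap_eq hpos (ha.nuMap_eq.trans hab)))
  have hsur : Function.Surjective f := by
    rintro ⟨y, hy⟩
    obtain ⟨z, hz⟩ := exists_nuMap_eq hsurj hy
    exact ⟨Quot.mk _ z, Subtype.ext hz⟩
  exact ⟨Continuous.homeoOfEquivCompactToT2 (f := Equiv.ofBijective f ⟨hinj, hsur⟩) hf,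
    fun _ => rfl⟩
end

section
/- Let σ : Fin(n+1) → Fin(k+1) be a monotone surjection and τ : Fin(n'+1) → Fin(n+1) a monotone map. Write σ ∘ τ = δ' ∘ σ', the unique factorization with σ' : Fin(n'+1) → Fin(k'+1) a monotone surjection and δ' : Fin(k'+1) → Fin(k+1) a monotone injection. For each i ∈ Fin(k'+1), τ maps the fiber σ'⁻¹{i} into the fiber σ⁻¹{δ'(i)}; let τ̂_i : σ'⁻¹{i} → σ⁻¹{δ'(i)} denote this restriction and (τ̂_i)_# : Δ(σ'⁻¹{i}) → Δ(σ⁻¹{δ'(i)}) its pushforward, (τ̂_i)_#(s)(j) = Σ_{j' ∈ σ'⁻¹{i}, τ(j') = j} s(j'). Then for every x ∈ ∏_{i ∈ Fin(k'+1)} Δ(σ'⁻¹{i}) and t ∈ Δ^{k'}, the pushforward τ_#(λ_{σ'}(x, t)) ∈ Δⁿ is given coordinatewise by: τ_#(λ_{σ'}(x, t))(j) = t(i)·((τ̂_i)_# x_i)(j) if σ(j) = δ'(i) for some i ∈ Fin(k'+1), and τ_#(λ_{σ'}(x, t))(j) = 0 if σ(j) is not in the range of δ'. -/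
/-- Let `σ : Fin (n+1) → Fin (k+1)` be a monotone surjection,
`τ : Fin (n'+1) → Fin (n+1)` a monotone map, and `σ ∘ τ = δ' ∘ σ'` the factorization
with `σ'` a monotone surjection and `δ'` a monotone injection. Then `τ` maps each
fiber `σ'⁻¹{i}` into `σ⁻¹{δ' i}`, and the pushforward `τ_#(λ_{σ'}(x, t))` is given
coordinatewise by `t i * ((τ̂_i)_# x_i)(j)` if `σ j = δ' i` for some `i`, and by `0`
if `σ j` is not in the range of `δ'`. -/
theorem stmt_13 (n k n' k' : ℕ)
    (σ : Fin (n + 1) → Fin (k + 1)) (hσm : Monotone σ) (hσs : Function.Surjective σ)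
    (τ : Fin (n' + 1) → Fin (n + 1)) (hτm : Monotone τ)
    (σ' : Fin (n' + 1) → Fin (k' + 1)) (hσ'm : Monotone σ') (hσ's : Function.Surjective σ')
    (δ' : Fin (k' + 1) → Fin (k + 1)) (hδ'm : Monotone δ') (hδ'i : Function.Injective δ')
    (hfact : σ ∘ τ = δ' ∘ σ') :
    (∀ (i : Fin (k' + 1)) (j' : Fin (n' + 1)), σ' j' = i → σ (τ j') = δ' i) ∧
    ∀ (x : ∀ i : Fin (k' + 1), {a : Fin (n' + 1) // σ' a = i} → ℝ),
      (∀ i, x i ∈ stdSimplex ℝ {a : Fin (n' + 1) // σ' a = i}) →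
      ∀ t ∈ stdSimplex ℝ (Fin (k' + 1)), ∀ j : Fin (n + 1),
        (∑ j' : Fin (n' + 1), if τ j' = j then t (σ' j') * x (σ' j') ⟨j', rfl⟩ else 0)
          = ∑ i : Fin (k' + 1),
              if δ' i = σ j then
                t i * ∑ a : {a : Fin (n' + 1) // σ' a = i},
                  (if τ (a : Fin (n' + 1)) = j then x i a else 0)
              else 0 := by
  have hτ : ∀ j', σ (τ j') = δ' (σ' j') := congrFun hfact
  refine ⟨fun i j' h => h ▸ hτ j', fun x _ t _ j => ?_⟩
  rw [← Fintype.sum_fiberwise σ']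
  refine Finset.sum_congr rfl fun i _ => ?_
  have hfiber : ∀ a : {a : Fin (n' + 1) // σ' a = i},
      (if τ a = j then t (σ' a) * x (σ' a) ⟨a, rfl⟩ else 0)
        = t i * if τ a = j then x i a else 0 := by
    rintro ⟨a, rfl⟩
    simp
  simp_rw [hfiber, ← Finset.mul_sum]
  split_ifs with h
  · rfl
  · rw [Finset.sum_eq_zero, mul_zero]
    rintro ⟨a, rfl⟩ -
    exact if_neg fun haj => h (by rw [← haj, hτ])
end

section
/- Let δ : Fin(k+1) → Fin(n+1) and δ' : Fin(k'+1) → Fin(n+1) be monotone injections. For a monotone injection γ : Fin(m+1) → Fin(n+1), let γ_# : Δᵐ → Δⁿ be the extension-by-zero embedding, γ_#(s)(j) = s(i) if j = γ(i) and 0 if j is not in the range of γ, and let ∂Δᵐ = { s ∈ Δᵐ : s(i) = 0 for some i }. Then δ_#(Δᵏ) ∩ δ'_#(Δ^{k'}) is not contained in δ'_#(∂Δ^{k'}) if and only if there exists a monotone injection δ'' : Fin(k'+1) → Fin(k+1) with δ' = δ ∘ δ''. -/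
/-- The extension-by-zero embedding `γ_# : ℝ^{m+1} → ℝ^{n+1}` associated with an
injection `γ : Fin (m+1) → Fin (n+1)`: `γ_#(s)(j) = s i` if `j = γ i` and `0` if `j`
is not in the range of `γ`. -/
noncomputable def extendByZero {m n : ℕ} (γ : Fin (m + 1) → Fin (n + 1))
    (s : Fin (m + 1) → ℝ) : Fin (n + 1) → ℝ :=
  fun j => ∑ i : Fin (m + 1), if γ i = j then s i else 0

theorem extendByZero_apply {m n : ℕ} {γ : Fin (m + 1) → Fin (n + 1)}
    (hγ : Function.Injective γ) (s : Fin (m + 1) → ℝ) (i : Fin (m + 1)) :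
    extendByZero γ s (γ i) = s i := by
  simp [extendByZero, hγ.eq_iff]

theorem extendByZero_injective {m n : ℕ} {γ : Fin (m + 1) → Fin (n + 1)}
    (hγ : Function.Injective γ) : Function.Injective (extendByZero γ) := by
  intro s t h
  ext i
  rw [← extendByZero_apply hγ s, h, extendByZero_apply hγ]

theorem mem_range_of_extendByZero_ne_zero {m n : ℕ} {γ : Fin (m + 1) → Fin (n + 1)}
    {s : Fin (m + 1) → ℝ} {j : Fin (n + 1)} (h : extendByZero γ s j ≠ 0) :
    ∃ i, γ i = j := by
  obtain ⟨i, -, hi⟩ := Finset.exists_ne_zero_of_sum_ne_zero h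
  exact ⟨i, by_contra fun hne => hi (if_neg hne)⟩

theorem extendByZero_mem_stdSimplex {m n : ℕ} (γ : Fin (m + 1) → Fin (n + 1))
    {s : Fin (m + 1) → ℝ} (hs : s ∈ stdSimplex ℝ (Fin (m + 1))) :
    extendByZero γ s ∈ stdSimplex ℝ (Fin (n + 1)) := by
  refine ⟨fun j => Finset.sum_nonneg fun i _ => ?_, ?_⟩
  · split_ifs
    exacts [hs.1 i, le_rfl]
  · simp only [extendByZero]
    rw [Finset.sum_comm]
    simpa using hs.2

theorem extendByZero_comp {l m n : ℕ} (γ : Fin (m + 1) → Fin (n + 1))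
    (β : Fin (l + 1) → Fin (m + 1)) (s : Fin (l + 1) → ℝ) :
    extendByZero (γ ∘ β) s = extendByZero γ (extendByZero β s) := by
  ext j
  have key (a : Fin (m + 1)) :
      (if γ a = j then ∑ i, if β i = a then s i else 0 else 0) =
        ∑ i, if β i = a then if γ (β i) = j then s i else 0 else 0 := by
    split_ifs with ha
    · refine Finset.sum_congr rfl fun i _ => ?_
      split_ifs <;> simp_all
    · refine (Finset.sum_eq_zero fun i _ => ?_).symm
      split_ifs <;> simp_all
  simp only [extendByZero, key]
  rw [Finset.sum_comm]
  simp

/-- For monotone injections `δ : Fin (k+1) → Fin (n+1)` and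
`δ' : Fin (k'+1) → Fin (n+1)`, the intersection `δ_#(Δᵏ) ∩ δ'_#(Δ^{k'})` is *not*
contained in `δ'_#(∂Δ^{k'})` if and only if `δ' = δ ∘ δ''` for some monotone
injection `δ'' : Fin (k'+1) → Fin (k+1)`. -/
theorem stmt_14 (n k k' : ℕ)
    (δ : Fin (k + 1) → Fin (n + 1)) (δ' : Fin (k' + 1) → Fin (n + 1))
    (hδm : Monotone δ) (hδi : Function.Injective δ)
    (hδ'm : Monotone δ') (hδ'i : Function.Injective δ') :
    ¬ (extendByZero δ '' stdSimplex ℝ (Fin (k + 1)) ∩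
        extendByZero δ' '' stdSimplex ℝ (Fin (k' + 1)) ⊆
        extendByZero δ' '' {s | s ∈ stdSimplex ℝ (Fin (k' + 1)) ∧ ∃ i, s i = 0}) ↔
      ∃ δ'' : Fin (k' + 1) → Fin (k + 1),
        Monotone δ'' ∧ Function.Injective δ'' ∧ δ' = δ ∘ δ'' := by
  constructor
  · intro h
    obtain ⟨_, ⟨⟨s, -, hs⟩, ⟨t, ht, rfl⟩⟩, hx⟩ := Set.not_subset.mp h
    have hne (i : Fin (k' + 1)) : t i ≠ 0 := fun hi => hx ⟨t, ⟨ht, i, hi⟩, rfl⟩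
    have hrange (i : Fin (k' + 1)) : ∃ a, δ a = δ' i := by
      apply mem_range_of_extendByZero_ne_zero (s := s)
      rw [hs, extendByZero_apply hδ'i]
      exact hne i
    choose δ'' hδ'' using hrange
    refine ⟨δ'', fun i j hij => ?_, fun i j hij => ?_, funext fun i => (hδ'' i).symm⟩
    · rw [← (hδm.strictMono_of_injective hδi).le_iff_le, hδ'', hδ'']
      exact hδ'm hij
    · apply hδ'i
      rw [← hδ'', ← hδ'', hij]
  · rintro ⟨δ'', -, -, rfl⟩ hsub
    let t : Fin (k' + 1) → ℝ := fun _ => ((k' : ℝ) + 1)⁻¹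
    have hpos : (0 : ℝ) < (k' : ℝ) + 1 := by positivity
    have ht : t ∈ stdSimplex ℝ (Fin (k' + 1)) := by
      refine ⟨fun _ => (inv_pos.mpr hpos).le, ?_⟩
      simp [t, hpos.ne']
    obtain ⟨u, ⟨-, i, hi⟩, hu⟩ := hsub
      ⟨⟨_, extendByZero_mem_stdSimplex δ'' ht, (extendByZero_comp δ δ'' t).symm⟩, ⟨t, ht, rfl⟩⟩
    rw [extendByZero_injective hδ'i hu] at hi
    exact (inv_pos.mpr hpos).ne' hi
end

section
/- Let S be a finite nonempty linearly ordered set and let f : 𝒫(S) → 𝒫(ℕ) be a map that respects disjoint unions and such that f(S) is finite. Then: (a) f is increasing if and only if for all s, s' ∈ S with s < s' one has f({s}) < f({s'}); and (b) if f is increasing, then f is hole-free if and only if f(S) = ∅ or f(S) = { k ∈ ℕ : min f(S) ≤ k ≤ max f(S) }. -/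
/-- A map that respects disjoint unions on a finite set is determined by its values on
singletons. -/
theorem mem_iff_exists_mem_singleton_of_disjoint_union {S T : Type*} [Finite S]
    {f : Set S → Set T}
    (hdu : ∀ A B : Set S, Disjoint A B →
      f (A ∪ B) = f A ∪ f B ∧ Disjoint (f A) (f B))
    (A : Set S) (x : T) : x ∈ f A ↔ ∃ s ∈ A, x ∈ f {s} := by
  induction A, A.toFinite using Set.Finite.induction_on with
  | empty =>
    have h : f ∅ = ∅ := disjoint_self.mp (hdu ∅ ∅ disjoint_bot_left).2
    simp [h]
  | @insert a A ha _ ih =>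
    rw [Set.insert_eq, (hdu {a} A (Set.disjoint_singleton_left.mpr ha)).1, Set.mem_union, ih]
    simp

/-- Let `S` be a finite nonempty linear order and
`f : 𝒫(S) → 𝒫(ℕ)` a map respecting disjoint unions with `f S` finite. Then:
(a) `f` is increasing iff `f {s} < f {s'}` whenever `s < s'`; and
(b) if `f` is increasing, then `f` is hole-free iff `f S = ∅` or
`f S = {k : min f S ≤ k ≤ max f S}`. -/
theorem stmt_16 (S : Type*) [LinearOrder S] [Fintype S] [Nonempty S]
    (f : Set S → Set ℕ)
    (hdu : ∀ A B : Set S, Disjoint A B →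
      f (A ∪ B) = f A ∪ f B ∧ Disjoint (f A) (f B))
    (hfin : (f Set.univ).Finite) :
    ((∀ A B : Set S, (∀ a ∈ A, ∀ b ∈ B, a < b) → ∀ x ∈ f A, ∀ y ∈ f B, x < y) ↔
      (∀ s s' : S, s < s' → ∀ x ∈ f {s}, ∀ y ∈ f {s'}, x < y)) ∧
    ((∀ A B : Set S, (∀ a ∈ A, ∀ b ∈ B, a < b) → ∀ x ∈ f A, ∀ y ∈ f B, x < y) →
      ((∀ I : Set S, (∀ x ∈ I, ∀ y ∈ I, ∀ z, x < z → z < y → z ∈ I) →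
          ∀ x ∈ f I, ∀ y ∈ f I, ∀ z, x < z → z < y → z ∈ f I) ↔
        (f Set.univ = ∅ ∨
          f Set.univ = Set.Icc (sInf (f Set.univ)) (sSup (f Set.univ))))) := by
  have hmem := mem_iff_exists_mem_singleton_of_disjoint_union hdu
  refine ⟨⟨fun h s s' hs => h {s} {s'} (by simpa using hs), fun h A B hAB x hx y hy => ?_⟩,
    fun hinc => ⟨fun hole => ?_, fun huniv I hI x hx y hy z hxz hzy => ?_⟩⟩
  · obtain ⟨s, hs, hxs⟩ := (hmem A x).mp hx
    obtain ⟨t, ht, hyt⟩ := (hmem B y).mp hy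
    exact h s t (hAB s hs t ht) x hxs y hyt
  · rcases (f Set.univ).eq_empty_or_nonempty with h0 | hne
    · exact Or.inl h0
    · refine Or.inr (Set.Subset.antisymm
        (fun k hk => ⟨Nat.sInf_le hk, le_csSup hfin.bddAbove hk⟩) fun k hk => ?_)
      have hmin := Nat.sInf_mem hne
      have hmax := Nat.sSup_mem hne hfin.bddAbove
      rcases hk.1.eq_or_lt with h | h
      · exact h ▸ hmin
      rcases hk.2.eq_or_lt with h' | h'
      · exact h' ▸ hmax
      exact hole Set.univ (fun _ _ _ _ _ _ _ => Set.mem_univ _) _ hmin _ hmax k h h'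
  · obtain ⟨s, hs, hxs⟩ := (hmem I x).mp hx
    obtain ⟨t, ht, hyt⟩ := (hmem I y).mp hy
    have hxu : x ∈ f Set.univ := (hmem _ x).mpr ⟨s, Set.mem_univ s, hxs⟩
    have hyu : y ∈ f Set.univ := (hmem _ y).mpr ⟨t, Set.mem_univ t, hyt⟩
    have hzu : z ∈ f Set.univ := by
      rcases huniv with h0 | hIcc
      · simp [h0] at hxu
      · rw [hIcc]
        exact ⟨(Nat.sInf_le hxu).trans hxz.le, hzy.le.trans (le_csSup hfin.bddAbove hyu)⟩
    obtain ⟨r, -, hzr⟩ := (hmem _ z).mp hzu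
    refine (hmem I z).mpr ⟨r, ?_, hzr⟩
    have hsr : s ≤ r := le_of_not_gt fun h =>
      (hinc {r} {s} (by simpa using h) z hzr x hxs).asymm hxz
    have hrt : r ≤ t := le_of_not_gt fun h =>
      (hinc {t} {r} (by simpa using h) y hyt z hzr).asymm hzy
    rcases hsr.eq_or_lt with rfl | hsr
    · exact hs
    rcases hrt.eq_or_lt with rfl | hrt
    · exact ht
    exact hI s hs t ht r hsr hrt
end

section
/- In the simplex category Δ, for every epimorphism σ : [n] → [k] and every monomorphism δ : [k'] → [k], there exist an object [m], a monomorphism ι : [m] → [n] and an epimorphism π : [m] → [k'] such that σ ∘ ι = δ ∘ π and the resulting commutative square (with ι and σ on one side and π and δ on the other) is a pullback square in Δ. -/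
open CategoryTheory

namespace SimplexCategory

/-- A morphism of `Δ` whose range is contained in that of a monomorphism factors through it. -/
theorem exists_comp_eq_of_range_subset {a b c : SimplexCategory} (f : a ⟶ c) (g : b ⟶ c) [Mono g]
    (h : Set.range f.toOrderHom ⊆ Set.range g.toOrderHom) : ∃ l : a ⟶ b, l ≫ g = f := by
  have hg : StrictMono g.toOrderHom :=
    g.toOrderHom.monotone.strictMono_of_injective (mono_iff_injective.1 inferInstance)
  choose l hl using fun x => h (Set.mem_range_self x)
  refine ⟨Hom.mk ⟨l, fun x y hxy => ?_⟩, ?_⟩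
  · rw [← hg.le_iff_le, hl, hl]
    exact f.toOrderHom.monotone hxy
  · apply Hom.ext
    ext1
    exact funext hl

/-- Every nonempty set of vertices of an object of `Δ` is the range of a monomorphism. -/
theorem exists_mono_range_eq {n : SimplexCategory} (s : Set (Fin (n.len + 1))) (hs : s.Nonempty) :
    ∃ (m : ℕ) (f : mk m ⟶ n), Mono f ∧ Set.range f.toOrderHom = s := by
  classical
  obtain ⟨m, hm⟩ := Nat.exists_eq_succ_of_ne_zero
    (Finset.card_ne_zero.2 (Set.toFinset_nonempty.2 hs))
  refine ⟨m, Hom.mk (s.toFinset.orderEmbOfFin hm).toOrderHom, ?_, ?_⟩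
  · exact mono_iff_injective.2 (s.toFinset.orderEmbOfFin hm).injective
  · exact (Finset.range_orderEmbOfFin _ hm).trans (Set.coe_toFinset s)

/-- A commutative square in `Δ` with two parallel monomorphisms is cartesian as soon as every
vertex sent into the range of the second one lies in the range of the first one. -/
theorem isPullback_of_preimage_range_subset {a b c d : SimplexCategory} {π : a ⟶ b} {ι : a ⟶ c}
    {δ : b ⟶ d} {σ : c ⟶ d} [Mono ι] [Mono δ] (w : π ≫ δ = ι ≫ σ)
    (h : σ.toOrderHom ⁻¹' Set.range δ.toOrderHom ⊆ Set.range ι.toOrderHom) :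
    IsPullback π ι δ σ := by
  have key (s : Limits.PullbackCone δ σ) : ∃ l : s.pt ⟶ a, l ≫ ι = s.snd := by
    apply exists_comp_eq_of_range_subset
    rintro _ ⟨x, rfl⟩
    exact h ⟨s.fst.toOrderHom x, congr_toOrderHom_apply s.condition x⟩
  choose l hl using key
  refine ⟨⟨w⟩, ⟨Limits.PullbackCone.IsLimit.mk w l (fun s => ?_) hl fun s t _ ht => ?_⟩⟩
  · rw [← cancel_mono δ, Category.assoc, w, ← Category.assoc, hl, s.condition]
  · rw [← cancel_mono ι, ht, hl]

end SimplexCategory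

/-- In the simplex category `Δ`, every pair of an epimorphism
`σ : [n] ⟶ [k]` and a monomorphism `δ : [k'] ⟶ [k]` fits into a pullback square:
there are `[m]`, a monomorphism `ι : [m] ⟶ [n]` and an epimorphism `π : [m] ⟶ [k']`
with `ι ≫ σ = π ≫ δ`, and the square is cartesian. -/
theorem stmt_18 (n k k' : ℕ)
    (σ : SimplexCategory.mk n ⟶ SimplexCategory.mk k)
    (δ : SimplexCategory.mk k' ⟶ SimplexCategory.mk k)
    [Epi σ] [Mono δ] :
    ∃ (m : ℕ) (ι : SimplexCategory.mk m ⟶ SimplexCategory.mk n)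
      (π : SimplexCategory.mk m ⟶ SimplexCategory.mk k'),
      Mono ι ∧ Epi π ∧ ι ≫ σ = π ≫ δ ∧ IsPullback π ι δ σ := by
  have hσ : Function.Surjective σ.toOrderHom := SimplexCategory.epi_iff_surjective.1 inferInstance
  have hδ : Function.Injective δ.toOrderHom := SimplexCategory.mono_iff_injective.1 inferInstance
  obtain ⟨m, ι, hι, hr⟩ := SimplexCategory.exists_mono_range_eq
    (σ.toOrderHom ⁻¹' Set.range δ.toOrderHom) ((Set.range_nonempty _).preimage hσ)
  obtain ⟨π, hπ⟩ := SimplexCategory.exists_comp_eq_of_range_subset (ι ≫ σ) δ (by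
    rintro _ ⟨x, rfl⟩
    exact hr.subset (Set.mem_range_self x))
  refine ⟨m, ι, π, hι, SimplexCategory.epi_iff_surjective.2 fun y => ?_, hπ.symm,
    SimplexCategory.isPullback_of_preimage_range_subset hπ hr.superset⟩
  obtain ⟨x, hx⟩ := hσ (δ.toOrderHom y)
  obtain ⟨z, rfl⟩ := hr.superset ⟨y, hx.symm⟩
  exact ⟨z, hδ ((SimplexCategory.congr_toOrderHom_apply hπ z).trans hx)⟩
end
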